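/- arXiv:2503.09589 — 6 statements merged into one kernel-verified Lean document; each statement's English description precedes it below -/
import Mathlib

section
/- The explicit formula solves the auxiliary transport problem: assume in addition that for each v the map x ↦ ν(x,v) is C¹ with sup_{x,v} ⟨v⟩^{−β} |∇_x ν(x,v)| ≤ C for some C > 0. Then for every (t,x,v) the function x ↦ χ^ε(t,x,v) is differentiable and χ^ε satisfies ⌈v⌉^{−β} ν(x,v) χ^ε(t,x,v) − ε ⌈v⌉^{−β} v·∇_x χ^ε(t,x,v) = ⌈v⌉^{−β} ν(x,v) φ(t,x). -/
open MeasureTheory Set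

noncomputable section

abbrev Euc (d : ℕ) := EuclideanSpace ℝ (Fin d)

/-- `⌈v⌉^b`: equal to `1` for `|v| ≤ 1` and to `|v|^b` for `|v| ≥ 1`. -/
noncomputable def jfloor {d : ℕ} (b : ℝ) (v : Euc d) : ℝ :=
  if ‖v‖ ≤ 1 then 1 else ‖v‖ ^ b

/-- The explicit solution `χ^ε` of the auxiliary transport problem. -/
noncomputable def chiAux {d : ℕ} (ν : Euc d → Euc d → ℝ) (β : ℝ)
    (φ : ℝ → Euc d → ℝ) (ε t : ℝ) (x v : Euc d) : ℝ :=
  ∫ z in Set.Ioi (0 : ℝ),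
    jfloor (-β) v * ν (x + (ε * jfloor (-β) v * z) • v) v *
      Real.exp (-(∫ s in (0 : ℝ)..z, jfloor (-β) v * ν (x + (ε * jfloor (-β) v * s) • v) v)) *
      φ t (x + (ε * jfloor (-β) v * z) • v)

section Helpers

variable {E : Type*} [NormedAddCommGroup E] [NormedSpace ℝ E]

/-- Inner path integral. -/
def pathI (n : E → ℝ) (w : E) (y : E) (z : ℝ) : ℝ := ∫ s in (0 : ℝ)..z, n (y + s • w)

/-- Derivative of the inner path integral. -/
def pathI' (n : E → ℝ) (w : E) (y : E) (z : ℝ) : E →L[ℝ] ℝ :=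
  ∫ s in (0 : ℝ)..z, fderiv ℝ n (y + s • w)

lemma cont_line (w y : E) : Continuous fun s : ℝ => y + s • w := by fun_prop

lemma pathI_hasFDerivAt (n : E → ℝ) (hn : ContDiff ℝ 1 n) (G : ℝ)
    (hG : ∀ y, ‖fderiv ℝ n y‖ ≤ G) (w y : E) (z : ℝ) :
    HasFDerivAt (fun y => pathI n w y z) (pathI' n w y z) y := by
  have hc := hn.continuous
  have hc' := hn.continuous_fderiv one_ne_zero
  unfold pathI pathI'
  refine intervalIntegral.hasFDerivAt_integral_of_dominated_of_fderiv_le (𝕜 := ℝ)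
    (F := fun y s => n (y + s • w)) (F' := fun y s => fderiv ℝ n (y + s • w))
    (s := Set.univ) (bound := fun _ => G) Filter.univ_mem ?_ ?_ ?_ ?_ ?_ ?_
  · exact Filter.Eventually.of_forall fun y => (hc.comp (cont_line w y)).aestronglyMeasurable
  · exact (hc.comp (cont_line w y)).intervalIntegrable _ _
  · have := (hc'.comp (cont_line w y))
    exact this.stronglyMeasurable.aestronglyMeasurable
  · exact Filter.Eventually.of_forall fun s _ y _ => hG _
  · exact intervalIntegrable_const
  · refine Filter.Eventually.of_forall fun s _ y _ => ?_
    have h1 : HasFDerivAt n (fderiv ℝ n (y + s • w)) (y + s • w) :=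
      (hn.differentiable one_ne_zero _).hasFDerivAt
    exact (hasFDerivAt_comp_add_right (s • w)).2 h1

lemma pathI_cont (n : E → ℝ) (hn : ContDiff ℝ 1 n) (w y : E) :
    Continuous (pathI n w y) :=
  intervalIntegral.continuous_primitive (μ := volume)
    (fun a b => (hn.continuous.comp (cont_line w y)).intervalIntegrable a b) 0

lemma pathI'_cont (n : E → ℝ) (hn : ContDiff ℝ 1 n) (w y : E) :
    Continuous (pathI' n w y) :=
  intervalIntegral.continuous_primitive (μ := volume)
    (fun a b => ((hn.continuous_fderiv one_ne_zero).comp (cont_line w y)).intervalIntegrable a b) 0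

lemma pathI'_norm (n : E → ℝ) (G : ℝ)
    (hG : ∀ y, ‖fderiv ℝ n y‖ ≤ G) (w y : E) (z : ℝ) (hz : 0 ≤ z) :
    ‖pathI' n w y z‖ ≤ G * z := by
  have := intervalIntegral.norm_integral_le_of_norm_le_const (a := 0) (b := z) (C := G)
    (f := fun s => fderiv ℝ n (y + s • w)) (fun s _ => hG _)
  simpa [pathI', abs_of_nonneg hz] using this

lemma pathI_lower (n : E → ℝ) (hn : ContDiff ℝ 1 n) (k : ℝ) (hk : ∀ y, k ≤ n y)
    (w y : E) (z : ℝ) (hz : 0 ≤ z) : k * z ≤ pathI n w y z := by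
  have := intervalIntegral.integral_mono_on (μ := volume) (a := 0) (b := z) hz
    (f := fun _ => k) (g := fun s => n (y + s • w))
    (continuous_const.intervalIntegrable _ _)
    ((hn.continuous.comp (cont_line w y)).intervalIntegrable _ _) (fun s _ => hk _)
  simpa [pathI, mul_comm] using this

/-- Integrand. -/
def integrandF (n f : E → ℝ) (w y : E) (z : ℝ) : ℝ :=
  n (y + z • w) * Real.exp (-(pathI n w y z)) * f (y + z • w)

/-- Derivative of the integrand. -/
def integrandF' (n f : E → ℝ) (w y : E) (z : ℝ) : E →L[ℝ] ℝ :=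
  (n (y + z • w) * Real.exp (-(pathI n w y z))) • fderiv ℝ f (y + z • w) +
  f (y + z • w) • (n (y + z • w) • (Real.exp (-(pathI n w y z)) • (-(pathI' n w y z))) +
    Real.exp (-(pathI n w y z)) • fderiv ℝ n (y + z • w))

lemma integrandF_cont (n f : E → ℝ) (hn : ContDiff ℝ 1 n) (hf : ContDiff ℝ 1 f) (w y : E) :
    Continuous (integrandF n f w y) := by
  have h1 := hn.continuous.comp (cont_line w y)
  have h2 := hf.continuous.comp (cont_line w y)
  have h3 := Real.continuous_exp.comp (pathI_cont n hn w y).neg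
  exact (h1.mul h3).mul h2

lemma integrandF'_cont (n f : E → ℝ) (hn : ContDiff ℝ 1 n) (hf : ContDiff ℝ 1 f) (w y : E) :
    Continuous (integrandF' n f w y) := by
  have h1 := hn.continuous.comp (cont_line w y)
  have h2 := hf.continuous.comp (cont_line w y)
  have h1' := (hn.continuous_fderiv one_ne_zero).comp (cont_line w y)
  have h2' := (hf.continuous_fderiv one_ne_zero).comp (cont_line w y)
  have h3 := Real.continuous_exp.comp (pathI_cont n hn w y).neg
  exact ((h1.mul h3).smul h2').add
    (h2.smul ((h1.smul (h3.smul (pathI'_cont n hn w y).neg)).add (h3.smul h1')))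

lemma integrandF_hasFDerivAt (n f : E → ℝ) (hn : ContDiff ℝ 1 n) (hf : ContDiff ℝ 1 f) (G : ℝ)
    (hG : ∀ y, ‖fderiv ℝ n y‖ ≤ G) (w y : E) (z : ℝ) :
    HasFDerivAt (fun y => integrandF n f w y z) (integrandF' n f w y z) y := by
  have h1 : HasFDerivAt (fun y => n (y + z • w)) (fderiv ℝ n (y + z • w)) y :=
    (hasFDerivAt_comp_add_right (z • w)).2 (hn.differentiable one_ne_zero (y + z • w)).hasFDerivAt
  have h2 : HasFDerivAt (fun y => f (y + z • w)) (fderiv ℝ f (y + z • w)) y :=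
    (hasFDerivAt_comp_add_right (z • w)).2 (hf.differentiable one_ne_zero (y + z • w)).hasFDerivAt
  have h3 := (pathI_hasFDerivAt n hn G hG w y z).fun_neg.exp
  exact (h1.fun_mul h3).fun_mul h2

lemma integrandF'_norm (n f : E → ℝ) (hn : ContDiff ℝ 1 n) (k K G M M' : ℝ) (hk0 : 0 < k)
    (hk : ∀ y, k ≤ n y) (hK : ∀ y, n y ≤ K) (hG : ∀ y, ‖fderiv ℝ n y‖ ≤ G)
    (hM : ∀ y, ‖f y‖ ≤ M) (hM' : ∀ y, ‖fderiv ℝ f y‖ ≤ M') (w y : E) (z : ℝ) (hz : 0 ≤ z) :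
    ‖integrandF' n f w y z‖ ≤ (K * M' + M * G) * Real.exp (-k * z)
      + (M * K * G) * (z * Real.exp (-k * z)) := by
  have hG0 : 0 ≤ G := (norm_nonneg _).trans (hG y)
  have hM0 : 0 ≤ M := (norm_nonneg _).trans (hM y)
  have hM'0 : 0 ≤ M' := (norm_nonneg _).trans (hM' y)
  have hn0 : 0 ≤ n (y + z • w) := hk0.le.trans (hk _)
  have hK0 : 0 ≤ K := hn0.trans (hK _)
  have he : Real.exp (-(pathI n w y z)) ≤ Real.exp (-k * z) := by
    apply Real.exp_le_exp.2
    have := pathI_lower n hn k hk w y z hz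
    linarith
  have e0 := (Real.exp_pos (-(pathI n w y z))).le
  have hp := pathI'_norm n G hG w y z hz
  calc ‖integrandF' n f w y z‖ ≤ (n (y + z • w) * Real.exp (-(pathI n w y z))) *
        ‖fderiv ℝ f (y + z • w)‖ + ‖f (y + z • w)‖ * (n (y + z • w) *
          (Real.exp (-(pathI n w y z)) * ‖pathI' n w y z‖) +
          Real.exp (-(pathI n w y z)) * ‖fderiv ℝ n (y + z • w)‖) := by
        unfold integrandF'
        refine (norm_add_le _ _).trans ?_
        gcongr
        · rw [norm_smul, Real.norm_of_nonneg (by positivity)]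
        · rw [norm_smul]
          gcongr
          refine (norm_add_le _ _).trans ?_
          rw [norm_smul, norm_smul, norm_smul, norm_neg, Real.norm_of_nonneg hn0,
            Real.norm_of_nonneg e0]
    _ ≤ (K * Real.exp (-k * z)) * M' + M * (K * (Real.exp (-k * z) * (G * z)) +
          Real.exp (-k * z) * G) := by
        gcongr
        · exact hK _
        · exact hM' _
        · exact hM _
        · exact hK _
        · exact hG _
    _ = _ := by ring

lemma exp_int (k : ℝ) (hk0 : 0 < k) :
    IntegrableOn (fun z : ℝ => Real.exp (-k * z)) (Set.Ioi 0) :=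
  integrableOn_exp_mul_Ioi (by linarith) 0

lemma mul_exp_int (k : ℝ) (hk0 : 0 < k) :
    IntegrableOn (fun z : ℝ => z * Real.exp (-k * z)) (Set.Ioi 0) := by
  have := integrableOn_rpow_mul_exp_neg_mul_rpow (p := 1) (s := 1) (b := k) (by norm_num)
    (by norm_num) hk0
  simpa using this

lemma integrandF_int (n f : E → ℝ) (hn : ContDiff ℝ 1 n) (hf : ContDiff ℝ 1 f)
    (k K M : ℝ) (hk0 : 0 < k)
    (hk : ∀ y, k ≤ n y) (hK : ∀ y, n y ≤ K) (hM : ∀ y, ‖f y‖ ≤ M) (w y : E) :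
    IntegrableOn (integrandF n f w y) (Set.Ioi 0) := by
  refine Integrable.mono' ((exp_int k hk0).const_mul (K * M))
    (integrandF_cont n f hn hf w y).aestronglyMeasurable ?_
  refine (ae_restrict_iff' measurableSet_Ioi).2 (Filter.Eventually.of_forall fun z hz => ?_)
  have hz : 0 < z := hz
  have hn0 : 0 ≤ n (y + z • w) := hk0.le.trans (hk _)
  have hK0 : 0 ≤ K := hn0.trans (hK _)
  have he : Real.exp (-(pathI n w y z)) ≤ Real.exp (-k * z) := by
    apply Real.exp_le_exp.2
    have := pathI_lower n hn k hk w y z hz.le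
    linarith
  unfold integrandF
  rw [norm_mul, norm_mul, Real.norm_of_nonneg hn0, Real.norm_of_nonneg (Real.exp_pos _).le]
  calc _ ≤ K * Real.exp (-k * z) * M := by
        gcongr
        · exact hK _
        · exact hM _
    _ = _ := by ring

lemma chi_hasFDerivAt (n f : E → ℝ) (hn : ContDiff ℝ 1 n) (hf : ContDiff ℝ 1 f)
    (k K G M M' : ℝ) (hk0 : 0 < k)
    (hk : ∀ y, k ≤ n y) (hK : ∀ y, n y ≤ K) (hG : ∀ y, ‖fderiv ℝ n y‖ ≤ G)
    (hM : ∀ y, ‖f y‖ ≤ M) (hM' : ∀ y, ‖fderiv ℝ f y‖ ≤ M') (w x : E) :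
    DifferentiableAt ℝ (fun y => ∫ z in Set.Ioi (0 : ℝ), integrandF n f w y z) x := by
  refine HasFDerivAt.differentiableAt (f' := ∫ z in Set.Ioi (0 : ℝ), integrandF' n f w x z) ?_
  refine hasFDerivAt_integral_of_dominated_of_fderiv_le (𝕜 := ℝ) (s := Set.univ)
    (bound := fun z => (K * M' + M * G) * Real.exp (-k * z)
      + (M * K * G) * (z * Real.exp (-k * z))) Filter.univ_mem ?_ ?_ ?_ ?_ ?_ ?_
  · exact Filter.Eventually.of_forall fun y => (integrandF_cont n f hn hf w y).aestronglyMeasurable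
  · exact integrandF_int n f hn hf k K M hk0 hk hK hM w x
  · exact (integrandF'_cont n f hn hf w x).stronglyMeasurable.aestronglyMeasurable
  · refine (ae_restrict_iff' measurableSet_Ioi).2 (Filter.Eventually.of_forall fun z hz y _ => ?_)
    exact integrandF'_norm n f hn k K G M M' hk0 hk hK hG hM hM' w y z (le_of_lt hz)
  · exact ((exp_int k hk0).const_mul _).add ((mul_exp_int k hk0).const_mul _)
  · exact Filter.Eventually.of_forall fun z y _ => integrandF_hasFDerivAt n f hn hf G hG w y z

lemma chi_shift (n f : E → ℝ) (hn : ContDiff ℝ 1 n) (hf : ContDiff ℝ 1 f)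
    (w x : E) (hint : IntegrableOn (integrandF n f w x) (Set.Ioi 0)) (h : ℝ) :
    ∫ z in Set.Ioi (0 : ℝ), integrandF n f w (x + h • w) z =
      Real.exp (pathI n w x h) * ((∫ z in Set.Ioi (0 : ℝ), integrandF n f w x z) -
        ∫ z in (0 : ℝ)..h, integrandF n f w x z) := by
  have key : ∀ z, integrandF n f w (x + h • w) z =
      Real.exp (pathI n w x h) * integrandF n f w x (z + h) := by
    intro z
    have hx : x + h • w + z • w = x + (z + h) • w := by rw [add_smul]; abel
    have hI : pathI n w (x + h • w) z = pathI n w x (z + h) - pathI n w x h := by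
      unfold pathI
      have hi : ∀ a b : ℝ, IntervalIntegrable (fun s : ℝ => n (x + s • w)) volume a b :=
        fun a b => (hn.continuous.comp (cont_line w x)).intervalIntegrable a b
      rw [intervalIntegral.integral_interval_sub_left (hi _ _) (hi _ _)]
      have := intervalIntegral.integral_comp_add_right (a := 0) (b := z)
        (fun s : ℝ => n (x + s • w)) h
      rw [zero_add] at this
      rw [← this]
      congr 1
      ext s
      congr 1
      rw [add_smul]; abel
    unfold integrandF
    rw [hx, hI, neg_sub, Real.exp_sub, Real.exp_neg]
    field_simp
  simp_rw [key]
  rw [integral_const_mul]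
  congr 1
  have h1 : ∫ z in Set.Ioi (0 : ℝ), integrandF n f w x (z + h) =
      ∫ z in Set.Ioi h, integrandF n f w x z := by
    have := (measurePreserving_add_right (volume : Measure ℝ) h).setIntegral_preimage_emb
      (measurableEmbedding_addRight h) (integrandF n f w x) (Set.Ioi h)
    simpa using this
  rw [h1, ← intervalIntegral.integral_interval_add_Ioi'
    ((integrandF_cont n f hn hf w x).intervalIntegrable h 0) hint,
    intervalIntegral.integral_symm 0 h]
  ring

lemma chi_dir (n f : E → ℝ) (hn : ContDiff ℝ 1 n) (hf : ContDiff ℝ 1 f)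
    (w x : E) (hint : IntegrableOn (integrandF n f w x) (Set.Ioi 0))
    (hd : DifferentiableAt ℝ (fun y => ∫ z in Set.Ioi (0 : ℝ), integrandF n f w y z) x) :
    fderiv ℝ (fun y => ∫ z in Set.Ioi (0 : ℝ), integrandF n f w y z) x w =
      n x * (∫ z in Set.Ioi (0 : ℝ), integrandF n f w x z) - n x * f x := by
  have hl : HasDerivAt (fun h : ℝ => x + h • w) w 0 := by
    simpa using ((hasDerivAt_id (0 : ℝ)).smul_const w).const_add x
  have hd' : HasFDerivAt (fun y => ∫ z in Set.Ioi (0 : ℝ), integrandF n f w y z)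
      (fderiv ℝ (fun y => ∫ z in Set.Ioi (0 : ℝ), integrandF n f w y z) x)
      (x + (0 : ℝ) • w) := by simpa using hd.hasFDerivAt
  have h1 := hd'.comp_hasDerivAt (0 : ℝ) hl
  have hcn := hn.continuous.comp (cont_line w x)
  have hcF := integrandF_cont n f hn hf w x
  have h2 : HasDerivAt (pathI n w x) (n x) 0 := by
    have := intervalIntegral.integral_hasDerivAt_right (hcn.intervalIntegrable 0 0)
      hcn.stronglyMeasurable.stronglyMeasurableAtFilter hcn.continuousAt
    have e : n x = n (x + (0 : ℝ) • w) := by simp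
    rw [e]
    exact this
  have h3 : HasDerivAt (fun h => ∫ z in (0 : ℝ)..h, integrandF n f w x z) (n x * f x) 0 := by
    have := intervalIntegral.integral_hasDerivAt_right (hcF.intervalIntegrable 0 0)
      hcF.stronglyMeasurable.stronglyMeasurableAtFilter hcF.continuousAt
    simpa [integrandF, pathI] using this
  have h4 := h2.exp.fun_mul (h3.const_sub (∫ z in Set.Ioi (0 : ℝ), integrandF n f w x z))
  have h5 : HasDerivAt (fun h : ℝ => ∫ z in Set.Ioi (0 : ℝ), integrandF n f w (x + h • w) z) _ 0 :=
    h4.congr_of_eventuallyEq (Filter.Eventually.of_forall fun h => chi_shift n f hn hf w x hint h)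
  have h6 := h1.unique h5
  rw [h6]
  simp [pathI]
  ring

end Helpers

/-- The explicit formula solves the auxiliary transport problem:
`⌈v⌉^{−β} ν χ^ε − ε ⌈v⌉^{−β} v·∇_x χ^ε = ⌈v⌉^{−β} ν φ`. -/
theorem chiAux_solves_auxiliary_problem (d : ℕ) (hd : 1 ≤ d)
    (β ν₁ ν₂ : ℝ) (hβ : β < 1) (hν₁ : 0 < ν₁) (h12 : ν₁ ≤ ν₂)
    (ν : Euc d → Euc d → ℝ)
    (hν_meas : Measurable fun p : Euc d × Euc d => ν p.1 p.2)
    (hν_bound : ∀ x v, ν₁ * Real.sqrt (1 + ‖v‖ ^ 2) ^ β ≤ ν x v ∧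
      ν x v ≤ ν₂ * Real.sqrt (1 + ‖v‖ ^ 2) ^ β)
    (C : ℝ) (hC : 0 < C)
    (hν_C1 : ∀ v, ContDiff ℝ 1 fun x => ν x v)
    (hν_grad : ∀ x v, Real.sqrt (1 + ‖v‖ ^ 2) ^ (-β) * ‖fderiv ℝ (fun y => ν y v) x‖ ≤ C)
    (φ : ℝ → Euc d → ℝ)
    (hφ : ContDiff ℝ (⊤ : ℕ∞) fun p : ℝ × Euc d => φ p.1 p.2)
    (hφc : HasCompactSupport fun p : ℝ × Euc d => φ p.1 p.2)
    (ε : ℝ) (hε : 0 < ε) (t : ℝ) (ht : 0 ≤ t) (x v : Euc d) :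
    DifferentiableAt ℝ (fun y => chiAux ν β φ ε t y v) x ∧
      jfloor (-β) v * ν x v * chiAux ν β φ ε t x v -
          ε * jfloor (-β) v * fderiv ℝ (fun y => chiAux ν β φ ε t y v) x v =
        jfloor (-β) v * ν x v * φ t x := by
  have hc : 0 < jfloor (-β) v := by
    unfold jfloor
    split_ifs with h
    · exact one_pos
    · exact Real.rpow_pos_of_pos (by linarith) _
  set c := jfloor (-β) v with hcdef
  have hb : 0 < Real.sqrt (1 + ‖v‖ ^ 2) := Real.sqrt_pos.2 (by positivity)
  set b := Real.sqrt (1 + ‖v‖ ^ 2) with hbdef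
  have hbp : 0 < b ^ β := Real.rpow_pos_of_pos hb _
  let n : Euc d → ℝ := fun y => c * ν y v
  let f : Euc d → ℝ := φ t
  let w : Euc d := (ε * c) • v
  have hn : ContDiff ℝ 1 n := contDiff_const.mul (hν_C1 v)
  have hpair : ContDiff ℝ (⊤ : ℕ∞) (fun y : Euc d => (t, y)) := contDiff_prodMk_right t
  have hf' : ContDiff ℝ (⊤ : ℕ∞) f := hφ.comp hpair
  have hf : ContDiff ℝ 1 f := hf'.of_le (by exact_mod_cast le_top)
  have hfc : HasCompactSupport f := by
    have hemb : Topology.IsClosedEmbedding (fun y : Euc d => (t, y)) :=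
      (Topology.IsClosedEmbedding.of_continuous_injective_isClosedMap (by fun_prop)
        (Prod.mk_right_injective t) (isClosedMap_prodMk_left t))
    exact hφc.comp_isClosedEmbedding hemb
  obtain ⟨M, hM⟩ := hfc.exists_bound_of_continuous hf.continuous
  obtain ⟨M', hM'⟩ := (hfc.fderiv (𝕜 := ℝ)).exists_bound_of_continuous
    (hf.continuous_fderiv one_ne_zero)
  have hk : ∀ y, c * (ν₁ * b ^ β) ≤ n y := fun y =>
    mul_le_mul_of_nonneg_left (hν_bound y v).1 hc.le
  have hK : ∀ y, n y ≤ c * (ν₂ * b ^ β) := fun y =>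
    mul_le_mul_of_nonneg_left (hν_bound y v).2 hc.le
  have hG : ∀ y, ‖fderiv ℝ n y‖ ≤ c * (C * b ^ β) := by
    intro y
    have h1 : fderiv ℝ n y = c • fderiv ℝ (fun y => ν y v) y :=
      fderiv_const_mul ((hν_C1 v).differentiable one_ne_zero y) c
    rw [h1, norm_smul, Real.norm_of_nonneg hc.le]
    apply mul_le_mul_of_nonneg_left _ hc.le
    have h2 := hν_grad y v
    rw [← hbdef, Real.rpow_neg hb.le, inv_mul_le_iff₀ hbp] at h2
    linarith
  have hchi : ∀ y, chiAux ν β φ ε t y v =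
      ∫ z in Set.Ioi (0 : ℝ), integrandF n f w y z := by
    intro y
    have hs : ∀ s : ℝ, (ε * c * s) • v = s • w := by
      intro s
      simp only [w, smul_smul]
      congr 1
      ring
    unfold chiAux integrandF pathI
    simp only [← hcdef, hs, n, f]
  have hk0 : 0 < c * (ν₁ * b ^ β) := by positivity
  have hint := integrandF_int n f hn hf _ _ M hk0 hk hK hM w x
  have hD := chi_hasFDerivAt n f hn hf _ _ _ M M' hk0 hk hK hG hM hM' w x
  have hdir := chi_dir n f hn hf w x hint hD
  simp_rw [hchi]
  refine ⟨hD, ?_⟩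
  have hw : ε * c * fderiv ℝ (fun y => ∫ z in Set.Ioi (0 : ℝ), integrandF n f w y z) x v =
      fderiv ℝ (fun y => ∫ z in Set.Ioi (0 : ℝ), integrandF n f w y z) x w := by
    rw [show w = (ε * c) • v from rfl, map_smul, smul_eq_mul]
  rw [hw, hdir]
  simp only [n, f]
  ring
end
end

section
/- Strong L²_F convergence of the auxiliary solution: let F : ℝ^d → (0,∞) be measurable with ∫_{ℝ^d} F(v) dv = 1. Then ∫₀^∞ ∫_{ℝ^d} ∫_{ℝ^d} F(v) ( χ^ε(t,x,v) − φ(t,x) )² dx dv dt → 0 as ε → 0. -/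
open MeasureTheory Set

noncomputable section

lemma aux_p (a : ℝ → ℝ) (ha : Measurable a) (c₁ c₂ : ℝ) (hc : 0 < c₁)
    (h1 : ∀ z, c₁ ≤ a z) (h2 : ∀ z, a z ≤ c₂) :
    (∀ z, 0 ≤ a z * Real.exp (-(∫ s in (0:ℝ)..z, a s))) ∧
    (∀ z, 0 < z → a z * Real.exp (-(∫ s in (0:ℝ)..z, a s)) ≤ c₂ * Real.exp (-c₁ * z)) ∧
    Integrable (fun z => a z * Real.exp (-(∫ s in (0:ℝ)..z, a s))) (volume.restrict (Ioi 0)) ∧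
    ∫ z in Ioi (0:ℝ), a z * Real.exp (-(∫ s in (0:ℝ)..z, a s)) = 1 := by
  have hc2 : 0 < c₂ := hc.trans_le ((h1 0).trans (h2 0))
  have hbd : ∀ z, ‖a z‖ ≤ c₂ := fun z => by
    rw [Real.norm_eq_abs, abs_of_nonneg (hc.le.trans (h1 z))]; exact h2 z
  have hint : ∀ x y : ℝ, IntervalIntegrable a volume x y := fun x y =>
    (intervalIntegrable_const (c := c₂)).mono_fun ha.aestronglyMeasurable
      (Filter.Eventually.of_forall fun z => (hbd z).trans (le_abs_self _))
  set A : ℝ → ℝ := fun z => ∫ s in (0:ℝ)..z, a s with hA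
  have hAge : ∀ z, 0 ≤ z → c₁ * z ≤ A z := fun z hz => by
    have := intervalIntegral.integral_mono_on hz (intervalIntegrable_const (c := c₁)) (hint 0 z)
      (fun x _ => h1 x)
    simpa [mul_comm] using this
  have hsub : ∀ x y, A y - A x = ∫ s in x..y, a s := fun x y =>
    intervalIntegral.integral_interval_sub_left (hint 0 y) (hint 0 x)
  have hAlip : ∀ x y, |A y - A x| ≤ c₂ * |y - x| := fun x y => by
    rw [hsub]
    exact intervalIntegral.norm_integral_le_of_norm_le_const (fun z _ => hbd z)
  have hAcont : Continuous A := intervalIntegral.continuous_primitive hint 0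
  have hexp : ∀ x y : ℝ, 0 ≤ x → x ≤ y → |Real.exp (-y) - Real.exp (-x)| ≤ |y - x| := by
    intro x y hx hxy
    rw [abs_sub_comm, abs_of_nonneg (by simpa using hxy), abs_of_nonneg (by linarith)]
    have e1 : Real.exp (-y) = Real.exp (-x) * Real.exp (-(y-x)) := by
      rw [← Real.exp_add]; ring_nf
    have e2 := Real.add_one_le_exp (-(y-x))
    have e3 : Real.exp (-x) ≤ 1 := Real.exp_le_one_iff.2 (by linarith)
    have e4 := Real.exp_pos (-x)
    rw [e1]
    nlinarith
  have hexp' : ∀ x y : ℝ, 0 ≤ x → 0 ≤ y → |Real.exp (-y) - Real.exp (-x)| ≤ |y - x| := by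
    intro x y hx hy
    rcases le_total x y with h | h
    · exact hexp x y hx h
    · rw [abs_sub_comm, abs_sub_comm y]; exact hexp y x hy h
  have hA0 : ∀ z, 0 ≤ z → 0 ≤ A z := fun z hz => (mul_nonneg hc.le hz).trans (hAge z hz)
  have hP : ∀ b : ℝ, 0 ≤ b → ∫ z in (0:ℝ)..b, a z * Real.exp (-A z) = 1 - Real.exp (-A b) := by
    intro b hb
    have hac : AbsolutelyContinuousOnInterval (fun z => Real.exp (-A z)) 0 b := by
      apply LipschitzOnWith.absolutelyContinuousOnInterval (K := Real.toNNReal c₂)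
      apply LipschitzOnWith.of_dist_le_mul
      intro x hx y hy
      rw [uIcc_of_le hb] at hx hy
      rw [Real.dist_eq, Real.dist_eq, Real.coe_toNNReal _ hc2.le]
      exact (hexp' _ _ (hA0 y hy.1) (hA0 x hx.1)).trans (hAlip _ _)
    have h := hac.integral_deriv_eq_sub
    have hloc : LocallyIntegrable a volume := by
      refine (locallyIntegrable_const c₂).mono ha.aestronglyMeasurable
        (Filter.Eventually.of_forall fun z => (hbd z).trans (le_abs_self _))
    have h' : ∫ z in (0:ℝ)..b, a z * Real.exp (-A z) = -∫ z in (0:ℝ)..b, deriv (fun z => Real.exp (-A z)) z := by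
      rw [← intervalIntegral.integral_neg]
      apply intervalIntegral.integral_congr_ae
      filter_upwards [LocallyIntegrable.ae_hasDerivAt_integral hloc] with z hz _
      have := ((hz 0).neg.exp).deriv
      simp only [Pi.neg_apply] at this
      change a z * Real.exp (-A z) = - deriv (fun z => Real.exp (-∫ s in (0:ℝ)..z, a s)) z
      rw [this]
      simp [A]; ring
    rw [h', h]
    simp [A]
  have hnn : ∀ z, 0 ≤ a z * Real.exp (-A z) := fun z =>
    mul_nonneg (hc.le.trans (h1 z)) (Real.exp_pos _).le
  have hle : ∀ z, 0 < z → a z * Real.exp (-A z) ≤ c₂ * Real.exp (-c₁ * z) := fun z hz => by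
    have := hAge z hz.le
    have h3 : Real.exp (-A z) ≤ Real.exp (-c₁ * z) := Real.exp_le_exp.2 (by linarith)
    exact mul_le_mul (h2 z) h3 (Real.exp_pos _).le hc2.le
  have hI : Integrable (fun z => a z * Real.exp (-A z)) (volume.restrict (Ioi 0)) := by
    refine Integrable.mono' (g := fun z => c₂ * Real.exp (-c₁ * z)) ?_ ?_ ?_
    · exact (integrableOn_exp_mul_Ioi (by linarith) 0).const_mul c₂
    · exact (ha.mul (by fun_prop)).aestronglyMeasurable
    · filter_upwards [ae_restrict_mem measurableSet_Ioi] with z hz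
      rw [Real.norm_eq_abs, abs_of_nonneg (hnn z)]; exact hle z hz
  refine ⟨hnn, hle, hI, ?_⟩
  have t1 := intervalIntegral_tendsto_integral_Ioi 0 hI Filter.tendsto_id
  have hAt : Filter.Tendsto A Filter.atTop Filter.atTop :=
    Filter.tendsto_atTop_mono' _ (by filter_upwards [Filter.eventually_ge_atTop 0] with z hz using hAge z hz)
      (Filter.tendsto_id.const_mul_atTop hc)
  have t2 : Filter.Tendsto (fun b => 1 - Real.exp (-A b)) Filter.atTop (nhds (1 - 0)) :=
    tendsto_const_nhds.sub (Real.tendsto_exp_neg_atTop_nhds_zero.comp hAt)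
  rw [sub_zero] at t2
  refine tendsto_nhds_unique t1 (t2.congr' ?_)
  filter_upwards [Filter.eventually_ge_atTop 0] with z hz using (hP z hz).symm

lemma aux_chi (a : ℝ → ℝ) (ha : Measurable a) (c₁ c₂ : ℝ) (hc : 0 < c₁)
    (h1 : ∀ z, c₁ ≤ a z) (h2 : ∀ z, a z ≤ c₂) (g : ℝ → ℝ) (hg : Continuous g) (g0 B : ℝ)
    (hgB : ∀ z, |g z| ≤ B) (hg0 : |g0| ≤ B) :
    ‖((∫ z in Ioi (0:ℝ), a z * Real.exp (-(∫ s in (0:ℝ)..z, a s)) * g z) - g0) ^ 2‖ₑ ≤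
      ENNReal.ofReal (2 * B) *
        ∫⁻ z in Ioi (0:ℝ), ENNReal.ofReal (c₂ * Real.exp (-c₁ * z)) * ‖g z - g0‖ₑ := by
  obtain ⟨hnn, hle, hI, h1'⟩ := aux_p a ha c₁ c₂ hc h1 h2
  set p : ℝ → ℝ := fun z => a z * Real.exp (-(∫ s in (0:ℝ)..z, a s)) with hp
  have hB : 0 ≤ B := (abs_nonneg _).trans hg0
  have hI2 : Integrable (fun z => p z * g z) (volume.restrict (Ioi 0)) :=
    hI.mul_bdd (c := B) hg.aestronglyMeasurable (Filter.Eventually.of_forall hgB)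
  have e : (∫ z in Ioi (0:ℝ), p z * g z) - g0 = ∫ z in Ioi (0:ℝ), p z * (g z - g0) := by
    simp_rw [mul_sub]
    rw [integral_sub hI2 (hI.mul_const g0), integral_mul_const, h1', one_mul]
  change ‖((∫ z in Ioi (0:ℝ), p z * g z) - g0) ^ 2‖ₑ ≤ _
  rw [e, pow_two, enorm_mul]
  gcongr
  · rw [← ofReal_norm]
    apply ENNReal.ofReal_le_ofReal
    calc _ ≤ ∫ z in Ioi (0:ℝ), p z * (2 * B) := by
          refine norm_integral_le_of_norm_le (hI.mul_const _) (Filter.Eventually.of_forall ?_)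
          intro z
          have hpz : |p z| = p z := abs_of_nonneg (hnn z)
          have hgz : |g z - g0| ≤ 2 * B := by
            have := abs_sub (g z) g0
            linarith [hgB z]
          simp only [norm_mul, Real.norm_eq_abs, hpz]
          exact mul_le_mul_of_nonneg_left hgz (hnn z)
      _ = 2 * B := by rw [integral_mul_const, h1', one_mul]
  · refine (enorm_integral_le_lintegral_enorm _).trans ?_
    refine setLIntegral_mono_ae' measurableSet_Ioi (Filter.Eventually.of_forall ?_)
    intro z hz
    rw [enorm_mul]
    gcongr
    rw [Real.enorm_eq_ofReal (hnn z)]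
    exact ENNReal.ofReal_le_ofReal (hle z hz)

lemma aux_phi {d : ℕ} (φ : ℝ → EuclideanSpace ℝ (Fin d) → ℝ)
    (hφ : ContDiff ℝ (⊤ : ℕ∞) fun p : ℝ × EuclideanSpace ℝ (Fin d) => φ p.1 p.2)
    (hφc : HasCompactSupport fun p : ℝ × EuclideanSpace ℝ (Fin d) => φ p.1 p.2) :
    ∃ (B R : ℝ) (K : ENNReal), K ≠ ⊤ ∧ (∀ t x, |φ t x| ≤ B) ∧
      ∀ t y, ∫⁻ x, ‖φ t (x + y) - φ t x‖ₑ ≤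
        (Icc (-R) R).indicator (fun _ => K * ENNReal.ofReal (min ‖y‖ 1)) t := by
  obtain ⟨L, hL⟩ := hφ.lipschitzWith_of_hasCompactSupport hφc (by simp)
  obtain ⟨B, hB⟩ := hφ.continuous.bounded_above_of_compact_support hφc
  obtain ⟨R, hR⟩ := hφc.isBounded.subset_closedBall 0
  have hB0 : 0 ≤ B := (norm_nonneg _).trans (hB 0)
  have hz : ∀ t x, φ t x ≠ 0 → |t| ≤ R ∧ ‖x‖ ≤ R := by
    intro t x h
    have := hR (subset_tsupport _ (show (t, x) ∈ Function.support _ from h))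
    rw [mem_closedBall_zero_iff, Prod.norm_def] at this
    simpa using this
  set C : ℝ := max L (2 * B) with hC
  have hC0 : 0 ≤ C := le_max_of_le_left L.2
  set S : Set (EuclideanSpace ℝ (Fin d)) := Metric.closedBall 0 R with hS
  have hSm : MeasurableSet S := Metric.isClosed_closedBall.measurableSet
  refine ⟨B, R, ENNReal.ofReal C * (2 * volume S), ?_, fun t x => hB (t, x), ?_⟩
  · refine ENNReal.mul_ne_top ENNReal.ofReal_ne_top (ENNReal.mul_ne_top (by simp) ?_)
    exact (isCompact_closedBall _ _).measure_lt_top.ne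
  intro t y
  by_cases ht : t ∈ Icc (-R) R
  · rw [indicator_of_mem ht]
    have key : ∀ x, ‖φ t (x + y) - φ t x‖ₑ ≤ ENNReal.ofReal C * ENNReal.ofReal (min ‖y‖ 1) *
        (S.indicator 1 (x + y) + S.indicator 1 x) := by
      intro x
      by_cases h : x + y ∈ S ∨ x ∈ S
      · have i1 : (1 : ENNReal) ≤ S.indicator 1 (x + y) + S.indicator 1 x := by
          rcases h with h | h <;> simp [h]
        refine le_trans ?_ (le_mul_of_one_le_right' i1)
        rw [← ofReal_norm, ← ENNReal.ofReal_mul hC0]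
        apply ENNReal.ofReal_le_ofReal
        have l1 : ‖φ t (x + y) - φ t x‖ ≤ L * ‖y‖ := by
          have := hL.dist_le_mul (t, x + y) (t, x)
          simpa [dist_eq_norm, Prod.norm_def] using this
        have l2 : ‖φ t (x + y) - φ t x‖ ≤ 2 * B := by
          have := norm_sub_le (φ t (x+y)) (φ t x)
          have h1 := hB (t, x+y)
          have h2 := hB (t, x)
          simp only at h1 h2
          linarith
        rcases min_choice ‖y‖ 1 with h | h <;> rw [h]
        · exact l1.trans (by gcongr; exact le_max_left _ _)
        · rw [mul_one]; exact l2.trans (le_max_right _ _)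
      · push Not at h
        have z1 : φ t (x + y) = 0 := by
          by_contra h'
          exact h.1 (by simpa [hS] using (hz _ _ h').2)
        have z2 : φ t x = 0 := by
          by_contra h'
          exact h.2 (by simpa [hS] using (hz _ _ h').2)
        simp [z1, z2]
    have m1 : Measurable (S.indicator (1 : EuclideanSpace ℝ (Fin d) → ENNReal)) := measurable_one.indicator hSm
    refine (lintegral_mono key).trans (le_of_eq ?_)
    rw [lintegral_const_mul _ (by fun_prop), lintegral_add_right _ m1,
      lintegral_add_right_eq_self (μ := volume) (S.indicator (1 : EuclideanSpace ℝ (Fin d) → ENNReal)) y, lintegral_indicator_one hSm]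
    ring
  · have : ∀ x, φ t x = 0 := by
      intro x
      by_contra h'
      exact ht (abs_le.1 (hz _ _ h').1)
    simp [this]

lemma aux_j (β s r : ℝ) (hr : 0 < r) (h1 : r ≤ s) (h2 : s ≤ 2 * r) :
    (2:ℝ) ^ (-|β|) ≤ r ^ (-β) * s ^ β ∧ r ^ (-β) * s ^ β ≤ 2 ^ |β| := by
  have e : r ^ (-β) * s ^ β = (s / r) ^ β := by
    rw [Real.div_rpow (hr.le.trans h1) hr.le, Real.rpow_neg hr.le]; field_simp
  have u1 : 1 ≤ s / r := (one_le_div hr).2 h1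
  have u2 : s / r ≤ 2 := (div_le_iff₀ hr).2 h2
  have u0 : 0 < s / r := by linarith
  rw [e]
  constructor
  · calc (2:ℝ) ^ (-|β|) ≤ (s / r) ^ (-|β|) :=
        Real.rpow_le_rpow_of_nonpos u0 u2 (by simp)
      _ ≤ _ := Real.rpow_le_rpow_of_exponent_le u1 (neg_abs_le β)
  · calc (s / r) ^ β ≤ (s / r) ^ |β| := Real.rpow_le_rpow_of_exponent_le u1 (le_abs_self β)
      _ ≤ _ := Real.rpow_le_rpow u0.le u2 (abs_nonneg _)

lemma aux_j' {d : ℕ} (β : ℝ) (v : Euc d) :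
    (2:ℝ) ^ (-|β|) ≤ jfloor (-β) v * Real.sqrt (1 + ‖v‖ ^ 2) ^ β ∧
      jfloor (-β) v * Real.sqrt (1 + ‖v‖ ^ 2) ^ β ≤ 2 ^ |β| := by
  have hv := norm_nonneg v
  unfold jfloor
  split_ifs with h
  · have := aux_j β (Real.sqrt (1 + ‖v‖ ^ 2)) 1 one_pos
      (Real.one_le_sqrt.2 (by nlinarith)) (Real.sqrt_le_iff.2 ⟨by norm_num, by nlinarith⟩)
    simpa using this
  · push Not at h
    exact aux_j β _ _ (by linarith) (Real.le_sqrt_of_sq_le (by linarith))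
      (Real.sqrt_le_iff.2 ⟨by linarith, by nlinarith⟩)

lemma jfloor_pos {d : ℕ} (b : ℝ) (v : Euc d) : 0 < jfloor b v := by
  unfold jfloor
  split_ifs with h
  · exact one_pos
  · push Not at h
    exact Real.rpow_pos_of_pos (by linarith) _

lemma jfloor_meas {d : ℕ} (b : ℝ) : Measurable (jfloor (d := d) b) := by
  unfold jfloor
  refine Measurable.ite (measurableSet_le (by fun_prop) (by fun_prop)) (by fun_prop) (by fun_prop)

/-- Strong `L²_F` convergence of the auxiliary solution:
`∫₀^∞ ∫∫ F(v) (χ^ε − φ)² dx dv dt → 0` as `ε → 0⁺`. -/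
theorem chiAux_L2F_convergence (d : ℕ) (hd : 1 ≤ d)
    (β ν₁ ν₂ : ℝ) (hβ : β < 1) (hν₁ : 0 < ν₁) (h12 : ν₁ ≤ ν₂)
    (ν : Euc d → Euc d → ℝ)
    (hν_meas : Measurable fun p : Euc d × Euc d => ν p.1 p.2)
    (hν_bound : ∀ x v, ν₁ * Real.sqrt (1 + ‖v‖ ^ 2) ^ β ≤ ν x v ∧
      ν x v ≤ ν₂ * Real.sqrt (1 + ‖v‖ ^ 2) ^ β)
    (F : Euc d → ℝ) (hF_pos : ∀ v, 0 < F v) (hF_meas : Measurable F)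
    (hF_int : Integrable F) (hF_mass : (∫ v, F v) = 1)
    (φ : ℝ → Euc d → ℝ)
    (hφ : ContDiff ℝ (⊤ : ℕ∞) fun p : ℝ × Euc d => φ p.1 p.2)
    (hφc : HasCompactSupport fun p : ℝ × Euc d => φ p.1 p.2) :
    Filter.Tendsto
      (fun ε => ∫ t in Set.Ioi (0 : ℝ), ∫ v, ∫ x,
        F v * (chiAux ν β φ ε t x v - φ t x) ^ 2)
      (nhdsWithin 0 (Set.Ioi 0)) (nhds 0) := by
  obtain ⟨B, R, K, hK, hB, hH⟩ := aux_phi φ hφ hφc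
  have hφcont : Continuous fun p : ℝ × Euc d => φ p.1 p.2 := hφ.continuous
  set c₁ : ℝ := ν₁ * 2 ^ (-|β|) with hc₁
  set c₂ : ℝ := ν₂ * 2 ^ |β| with hc₂
  have hc1 : 0 < c₁ := by positivity
  have hν₂ : 0 < ν₂ := hν₁.trans_le h12
  have hc2 : 0 < c₂ := by positivity
  have hbd : ∀ x v, c₁ ≤ jfloor (-β) v * ν x v ∧ jfloor (-β) v * ν x v ≤ c₂ := by
    intro x v
    have hj := jfloor_pos (-β) v
    obtain ⟨j1, j2⟩ := aux_j' β v
    obtain ⟨b1, b2⟩ := hν_bound x v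
    constructor
    · calc c₁ ≤ ν₁ * (jfloor (-β) v * Real.sqrt (1 + ‖v‖ ^ 2) ^ β) := mul_le_mul_of_nonneg_left j1 hν₁.le
        _ = jfloor (-β) v * (ν₁ * Real.sqrt (1 + ‖v‖ ^ 2) ^ β) := by ring
        _ ≤ _ := by gcongr
    · calc _ ≤ jfloor (-β) v * (ν₂ * Real.sqrt (1 + ‖v‖ ^ 2) ^ β) := by gcongr
        _ = ν₂ * (jfloor (-β) v * Real.sqrt (1 + ‖v‖ ^ 2) ^ β) := by ring
        _ ≤ _ := mul_le_mul_of_nonneg_left j2 hν₂.le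
  set Z : ENNReal := ∫⁻ z in Ioi (0:ℝ),
    ENNReal.ofReal (c₂ * (1 + 2 / c₁) * Real.exp (-(c₁ / 2) * z)) with hZ
  have hZt : Z ≠ ⊤ := by
    have : Integrable (fun z => c₂ * (1 + 2 / c₁) * Real.exp (-(c₁ / 2) * z))
        (volume.restrict (Ioi (0:ℝ))) :=
      (integrableOn_exp_mul_Ioi (by linarith) 0).const_mul _
    exact this.lintegral_lt_top.ne
  set w : Euc d → ℝ := fun v => jfloor (-β) v * ‖v‖ with hw
  have hw0 : ∀ v, 0 ≤ w v := fun v => mul_nonneg (jfloor_pos _ _).le (norm_nonneg _)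
  have hwm : Measurable w := (jfloor_meas _).mul measurable_norm
  set D : ENNReal := ENNReal.ofReal (2 * B) * (K * Z) with hD
  have hDt : D ≠ ⊤ :=
    ENNReal.mul_ne_top ENNReal.ofReal_ne_top (ENNReal.mul_ne_top hK hZt)
  -- the bound of the `x` integral
  have hx : ∀ ε, 0 < ε → ∀ t v, ∫⁻ x, ‖F v * (chiAux ν β φ ε t x v - φ t x) ^ 2‖ₑ ≤
      (Icc (-R) R).indicator 1 t * (D * ENNReal.ofReal (F v * min (ε * w v) 1)) := by
    intro ε hε t v
    have hj := jfloor_pos (-β) v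
    have step1 : ∀ x, ‖F v * (chiAux ν β φ ε t x v - φ t x) ^ 2‖ₑ ≤
        ENNReal.ofReal (F v) * (ENNReal.ofReal (2 * B) *
          ∫⁻ z in Ioi (0:ℝ), ENNReal.ofReal (c₂ * Real.exp (-c₁ * z)) *
            ‖φ t (x + (ε * jfloor (-β) v * z) • v) - φ t x‖ₑ) := by
      intro x
      rw [enorm_mul, Real.enorm_eq_ofReal (hF_pos v).le]
      gcongr
      refine aux_chi (fun z => jfloor (-β) v * ν (x + (ε * jfloor (-β) v * z) • v) v) ?_ c₁ c₂ hc1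
        (fun z => (hbd _ v).1) (fun z => (hbd _ v).2)
        (fun z => φ t (x + (ε * jfloor (-β) v * z) • v)) ?_ (φ t x) B (fun z => hB _ _) (hB _ _)
      · refine Measurable.const_mul ?_ _
        exact hν_meas.comp (f := fun z : ℝ => (x + (ε * jfloor (-β) v * z) • v, v)) (by fun_prop)
      · exact hφcont.comp (g := fun p : ℝ × Euc d => φ p.1 p.2)
          (f := fun z : ℝ => (t, x + (ε * jfloor (-β) v * z) • v)) (by fun_prop)
    have hm : Measurable fun q : Euc d × ℝ => ENNReal.ofReal (c₂ * Real.exp (-c₁ * q.2)) *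
            ‖φ t (q.1 + (ε * jfloor (-β) v * q.2) • v) - φ t q.1‖ₑ := by
      have k1 : Continuous fun q : Euc d × ℝ => φ t (q.1 + (ε * jfloor (-β) v * q.2) • v) :=
        hφcont.comp (g := fun p : ℝ × Euc d => φ p.1 p.2)
          (f := fun q : Euc d × ℝ => (t, q.1 + (ε * jfloor (-β) v * q.2) • v)) (by fun_prop)
      have k2 : Continuous fun q : Euc d × ℝ => φ t q.1 :=
        hφcont.comp (g := fun p : ℝ × Euc d => φ p.1 p.2)
          (f := fun q : Euc d × ℝ => (t, q.1)) (by fun_prop)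
      have k3 : Measurable fun q : Euc d × ℝ =>
          ‖φ t (q.1 + (ε * jfloor (-β) v * q.2) • v) - φ t q.1‖ₑ := (k1.sub k2).measurable.enorm
      exact Measurable.mul (by fun_prop) k3
    refine (lintegral_mono step1).trans ?_
    rw [lintegral_const_mul' _ _ ENNReal.ofReal_ne_top,
      lintegral_const_mul' _ _ ENNReal.ofReal_ne_top,
      lintegral_lintegral_swap hm.aemeasurable]
    have step2 : ∀ z ∈ Ioi (0:ℝ), ∫⁻ x, ENNReal.ofReal (c₂ * Real.exp (-c₁ * z)) *
            ‖φ t (x + (ε * jfloor (-β) v * z) • v) - φ t x‖ₑ ≤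
        ((Icc (-R) R).indicator 1 t * K * ENNReal.ofReal (min (ε * w v) 1)) *
        ENNReal.ofReal (c₂ * (1 + 2 / c₁) * Real.exp (-(c₁ / 2) * z)) := by
      intro z hz
      rw [mem_Ioi] at hz
      rw [lintegral_const_mul' _ _ ENNReal.ofReal_ne_top]
      have n1 : ‖(ε * jfloor (-β) v * z) • v‖ = z * (ε * w v) := by
        rw [norm_smul, Real.norm_eq_abs, abs_of_nonneg (by positivity)]
        simp only [hw]; ring
      have hH' := hH t ((ε * jfloor (-β) v * z) • v)
      rw [n1] at hH'
      have hew : 0 ≤ ε * w v := mul_nonneg hε.le (hw0 v)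
      have m1 : min (z * (ε * w v)) 1 ≤ (1 + z) * min (ε * w v) 1 := by
        rcases min_choice (ε * w v) 1 with h | h <;> rw [h]
        · exact (min_le_left _ _).trans (by nlinarith)
        · exact (min_le_right _ _).trans (by linarith)
      have m0 : 0 ≤ min (ε * w v) 1 := le_min hew zero_le_one
      have ex : c₂ * Real.exp (-c₁ * z) * (1 + z) ≤
          c₂ * (1 + 2 / c₁) * Real.exp (-(c₁ / 2) * z) := by
        have e1 : Real.exp (-c₁ * z) = Real.exp (-(c₁ / 2) * z) * Real.exp (-(c₁ / 2) * z) := by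
          rw [← Real.exp_add]; ring_nf
        have e2 : Real.exp (-(c₁ / 2) * z) * Real.exp (c₁ / 2 * z) = 1 := by
          rw [← Real.exp_add]; simp
        have e3 := Real.add_one_le_exp (c₁ / 2 * z)
        have e4 := Real.exp_pos (-(c₁ / 2) * z)
        have e5 : 1 + z ≤ (1 + 2 / c₁) * Real.exp (c₁ / 2 * z) := by
          have q : z = 2 / c₁ * (c₁ / 2 * z) := by field_simp
          have q1 : 0 < 2 / c₁ := by positivity
          have q2 : 0 < c₁ / 2 * z := by positivity
          calc 1 + z = 1 + 2 / c₁ * (c₁ / 2 * z) := by rw [← q]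
            _ ≤ 1 * Real.exp (c₁ / 2 * z) + 2 / c₁ * Real.exp (c₁ / 2 * z) := by
                gcongr <;> linarith
            _ = _ := by ring
        calc c₂ * Real.exp (-c₁ * z) * (1 + z)
            ≤ c₂ * Real.exp (-c₁ * z) * ((1 + 2 / c₁) * Real.exp (c₁ / 2 * z)) := by gcongr
          _ = c₂ * (1 + 2 / c₁) * Real.exp (-(c₁ / 2) * z) *
              (Real.exp (-(c₁ / 2) * z) * Real.exp (c₁ / 2 * z)) := by rw [e1]; ring
          _ = _ := by rw [e2, mul_one]
      by_cases ht : t ∈ Icc (-R) R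
      · rw [indicator_of_mem ht] at hH' ⊢
        simp only [Pi.one_apply, one_mul]
        calc _ ≤ ENNReal.ofReal (c₂ * Real.exp (-c₁ * z)) *
              (K * ENNReal.ofReal ((1 + z) * min (ε * w v) 1)) := by
              gcongr
              exact hH'.trans (by gcongr)
          _ = K * ENNReal.ofReal (min (ε * w v) 1) *
              ENNReal.ofReal (c₂ * Real.exp (-c₁ * z) * (1 + z)) := by
              rw [ENNReal.ofReal_mul (by linarith : 0 ≤ 1 + z),
                ENNReal.ofReal_mul (by positivity : 0 ≤ c₂ * Real.exp (-c₁ * z))]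
              ring
          _ ≤ _ := by gcongr
      · rw [indicator_of_notMem ht] at hH' ⊢
        rw [nonpos_iff_eq_zero.1 hH']
        simp
    have hfin : (Icc (-R) R).indicator (1 : ℝ → ENNReal) t * K *
        ENNReal.ofReal (min (ε * w v) 1) ≠ ⊤ := by
      refine ENNReal.mul_ne_top (ENNReal.mul_ne_top ?_ hK) ENNReal.ofReal_ne_top
      by_cases ht : t ∈ Icc (-R) R <;> simp [ht]
    calc _ ≤ ENNReal.ofReal (F v) * (ENNReal.ofReal (2 * B) *
          ∫⁻ z in Ioi (0:ℝ), ((Icc (-R) R).indicator 1 t * K * ENNReal.ofReal (min (ε * w v) 1)) *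
        ENNReal.ofReal (c₂ * (1 + 2 / c₁) * Real.exp (-(c₁ / 2) * z))) := by
          refine mul_le_mul_right (mul_le_mul_right ?_ _) _
          exact setLIntegral_mono_ae' measurableSet_Ioi (Filter.Eventually.of_forall step2)
      _ = _ := by
          rw [lintegral_const_mul' _ _ hfin, ENNReal.ofReal_mul (hF_pos v).le, hD, ← hZ]
          ring
  -- the full bound
  have hfull : ∀ ε, 0 < ε → ‖∫ t in Set.Ioi (0 : ℝ), ∫ v, ∫ x,
        F v * (chiAux ν β φ ε t x v - φ t x) ^ 2‖ₑ ≤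
      volume (Icc (-R) R) * (D * ENNReal.ofReal (∫ v, F v * min (ε * w v) 1)) := by
    intro ε hε
    have hmin : ∀ v, 0 ≤ min (ε * w v) 1 := fun v =>
      le_min (mul_nonneg hε.le (hw0 v)) zero_le_one
    have hi : Integrable (fun v => F v * min (ε * w v) 1) :=
      hF_int.mul_bdd (c := 1) (by fun_prop) (Filter.Eventually.of_forall fun v => by
        rw [Real.norm_eq_abs, abs_of_nonneg (hmin v)]; exact min_le_right _ _)
    rw [ofReal_integral_eq_lintegral_ofReal hi
      (Filter.Eventually.of_forall fun v => mul_nonneg (hF_pos v).le (hmin v))]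
    have hv : ∀ t, ‖∫ v, ∫ x, F v * (chiAux ν β φ ε t x v - φ t x) ^ 2‖ₑ ≤
        (Icc (-R) R).indicator 1 t * (D * ∫⁻ v, ENNReal.ofReal (F v * min (ε * w v) 1)) := by
      intro t
      refine (enorm_integral_le_lintegral_enorm _).trans ?_
      refine (lintegral_mono fun v =>
        (enorm_integral_le_lintegral_enorm _).trans (hx ε hε t v)).trans ?_
      rw [lintegral_const_mul' _ _ (by by_cases ht : t ∈ Icc (-R) R <;> simp [ht]),
        lintegral_const_mul' _ _ hDt]
    refine (enorm_integral_le_lintegral_enorm _).trans ?_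
    refine (setLIntegral_le_lintegral _ _).trans ?_
    refine (lintegral_mono hv).trans ?_
    rw [lintegral_mul_const _ (measurable_one.indicator measurableSet_Icc),
      lintegral_indicator_one measurableSet_Icc]
  -- dominated convergence in `v`
  have hlim : Filter.Tendsto (fun ε : ℝ => ∫ v, F v * min (ε * w v) 1)
      (nhdsWithin 0 (Ioi 0)) (nhds 0) := by
    have : Filter.Tendsto (fun ε : ℝ => ∫ v, F v * min (ε * w v) 1)
      (nhdsWithin 0 (Ioi 0)) (nhds (∫ v : Euc d, (0:ℝ))) := by
      refine tendsto_integral_filter_of_dominated_convergence F ?_ ?_ hF_int ?_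
      · exact Filter.Eventually.of_forall fun ε => by fun_prop
      · filter_upwards [self_mem_nhdsWithin] with ε hε
        refine Filter.Eventually.of_forall fun v => ?_
        have hmin : 0 ≤ min (ε * w v) 1 :=
          le_min (mul_nonneg (le_of_lt hε) (hw0 v)) zero_le_one
        rw [Real.norm_eq_abs, abs_of_nonneg (mul_nonneg (hF_pos v).le hmin)]
        exact mul_le_of_le_one_right (hF_pos v).le (min_le_right _ _)
      · refine Filter.Eventually.of_forall fun v => ?_
        have hc : Continuous fun ε : ℝ => F v * min (ε * w v) 1 := by fun_prop
        have := (hc.tendsto 0).mono_left (nhdsWithin_le_nhds (s := Ioi 0))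
        simpa using this
    simpa using this
  rw [tendsto_zero_iff_enorm_tendsto_zero]
  have hbig : Filter.Tendsto (fun ε : ℝ => volume (Icc (-R) R) *
      (D * ENNReal.ofReal (∫ v, F v * min (ε * w v) 1))) (nhdsWithin 0 (Ioi 0)) (nhds 0) := by
    have t1 := ENNReal.tendsto_ofReal hlim
    have t2 := ENNReal.Tendsto.const_mul t1 (Or.inr hDt)
    have t3 := ENNReal.Tendsto.const_mul (a := volume (Icc (-R) R)) t2
      (Or.inr (by simp))
    simpa using t3
  refine tendsto_of_tendsto_of_tendsto_of_le_of_le' tendsto_const_nhds hbig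
    (Filter.Eventually.of_forall fun _ => zero_le) ?_
  filter_upwards [self_mem_nhdsWithin] with ε hε using hfull ε hε
end
end

section
/- Strong L²_F convergence of the time derivative of the auxiliary solution: let F : ℝ^d → (0,∞) be measurable with ∫_{ℝ^d} F(v) dv = 1. Then ∫₀^∞ ∫_{ℝ^d} ∫_{ℝ^d} F(v) ( ∂_t χ^ε(t,x,v) − ∂_t φ(t,x) )² dx dv dt → 0 as ε → 0. -/
open MeasureTheory Set

noncomputable section

theorem aux_prob (f : ℝ → ℝ) (hf : Measurable f) (a b : ℝ) (ha : 0 < a)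
    (hfa : ∀ z, a ≤ f z) (hfb : ∀ z, f z ≤ b) :
    (∀ z, 0 ≤ z → a * z ≤ ∫ s in (0:ℝ)..z, f s) ∧
    IntegrableOn (fun z => f z * Real.exp (-(∫ s in (0:ℝ)..z, f s))) (Ioi 0) ∧
    (∫ z in Ioi (0:ℝ), f z * Real.exp (-(∫ s in (0:ℝ)..z, f s))) = 1 := by
  have hb : 0 < b := lt_of_lt_of_le ha ((hfa 0).trans (hfb 0))
  have hnorm : ∀ z, ‖f z‖ ≤ b := fun z => by
    rw [Real.norm_eq_abs, abs_of_nonneg (ha.le.trans (hfa z))]; exact hfb z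
  have hloc : LocallyIntegrable f volume := by
    refine LocallyIntegrable.mono (locallyIntegrable_const b) hf.aestronglyMeasurable ?_
    refine Filter.Eventually.of_forall fun z => ?_
    rw [Real.norm_of_nonneg hb.le]; exact hnorm z
  have hii : ∀ x y : ℝ, IntervalIntegrable f volume x y := fun x y =>
    ((hloc.integrableOn_isCompact isCompact_uIcc).intervalIntegrable)
  set A : ℝ → ℝ := fun z => ∫ s in (0:ℝ)..z, f s with hA
  have hsub : ∀ x y, A y - A x = ∫ s in x..y, f s := fun x y =>
    intervalIntegral.integral_interval_sub_left (hii _ _) (hii _ _)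
  have hlow : ∀ z, 0 ≤ z → a * z ≤ A z := by
    intro z hz
    have := intervalIntegral.integral_mono_on hz (intervalIntegrable_const (c := a)) (hii 0 z) (fun x _ => hfa x)
    simp at this
    linarith
  have hAcont : Continuous A := intervalIntegral.continuous_primitive hii 0
  have hlip : ∀ x y, |A y - A x| ≤ b * |y - x| := by
    intro x y
    rw [hsub]
    exact intervalIntegral.norm_integral_le_of_norm_le_const (fun z _ => hnorm z)
  have hexp : ∀ u w : ℝ, 0 ≤ u → 0 ≤ w → |Real.exp (-u) - Real.exp (-w)| ≤ |u - w| := by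
    have key : ∀ u w : ℝ, 0 ≤ u → u ≤ w → |Real.exp (-u) - Real.exp (-w)| ≤ |u - w| := by
      intro u w hu huw
      have h1 : Real.exp (-w) ≤ Real.exp (-u) := Real.exp_le_exp.2 (by linarith)
      have h2 : Real.exp (-u) ≤ 1 := Real.exp_le_one_iff.2 (by linarith)
      have h3 : Real.exp (-w) = Real.exp (-u) * Real.exp (-(w-u)) := by rw [← Real.exp_add]; ring_nf
      have h4 := Real.add_one_le_exp (-(w-u))
      rw [abs_of_nonneg (by linarith), abs_of_nonpos (by linarith), h3]
      nlinarith [Real.exp_pos (-u)]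
    intro u w hu hw
    rcases le_total u w with h | h
    · exact key u w hu h
    · rw [abs_sub_comm, abs_sub_comm u w]; exact key w u hw h
  set g : ℝ → ℝ := fun z => Real.exp (-(A z)) with hg
  have hAC : ∀ Z, 0 ≤ Z → AbsolutelyContinuousOnInterval g 0 Z := by
    intro Z hZ
    refine LipschitzOnWith.absolutelyContinuousOnInterval (K := ⟨b, hb.le⟩) ?_
    refine LipschitzOnWith.of_dist_le_mul ?_
    intro x hx y hy
    rw [uIcc_of_le hZ] at hx hy
    have hx' := (mul_nonneg ha.le hx.1).trans (hlow x hx.1)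
    have hy' := (mul_nonneg ha.le hy.1).trans (hlow y hy.1)
    rw [Real.dist_eq, Real.dist_eq]
    exact (hexp _ _ hx' hy').trans (hlip y x)
  have hder : ∀ᵐ x, deriv g x = -(f x * g x) := by
    filter_upwards [LocallyIntegrable.ae_hasDerivAt_integral hloc] with x hx
    have := ((hx 0).neg.exp).deriv
    rw [show g = fun x => Real.exp ((-fun z => ∫ s in (0:ℝ)..z, f s) x) from rfl, this]
    simp [mul_comm]
  have hint : ∀ Z, 0 ≤ Z → ∫ z in (0:ℝ)..Z, f z * g z = 1 - g Z := by
    intro Z hZ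
    have h1 := (hAC Z hZ).integral_deriv_eq_sub
    rw [intervalIntegral.integral_congr_ae (g := fun x => -(f x * g x))
      (by filter_upwards [hder] with x hx _ using hx)] at h1
    rw [intervalIntegral.integral_neg] at h1
    have : g 0 = 1 := by simp [hg, hA]
    linarith
  have hgm : Measurable g := (Real.continuous_exp.comp hAcont.neg).measurable
  have hI : IntegrableOn (fun z => f z * g z) (Ioi 0) := by
    refine Integrable.mono' ((exp_neg_integrableOn_Ioi 0 ha).const_mul b) (hf.mul hgm).aestronglyMeasurable ?_
    refine (ae_restrict_iff' measurableSet_Ioi).2 (Filter.Eventually.of_forall fun z hz => ?_)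
    have hz : 0 < z := hz
    rw [norm_mul]
    refine mul_le_mul (hnorm z) ?_ (norm_nonneg _) hb.le
    rw [Real.norm_eq_abs, hg, Real.abs_exp]
    exact Real.exp_le_exp.2 (by linarith [hlow z hz.le])
  refine ⟨hlow, hI, ?_⟩
  have t1 := intervalIntegral_tendsto_integral_Ioi 0 hI Filter.tendsto_id
  have t2 : Filter.Tendsto (fun Z => 1 - g Z) Filter.atTop (nhds (1 - 0)) := by
    refine Filter.Tendsto.sub tendsto_const_nhds ?_
    refine Real.tendsto_exp_neg_atTop_nhds_zero.comp ?_
    refine Filter.tendsto_atTop_mono' _ ?_ (Filter.tendsto_id.const_mul_atTop ha)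
    filter_upwards [Filter.eventually_ge_atTop 0] with z hz using hlow z hz
  refine (tendsto_nhds_unique t1 (t2.congr' ?_)).trans (by norm_num)
  filter_upwards [Filter.eventually_ge_atTop 0] with z hz using (hint z hz).symm

theorem aux_jensen (f : ℝ → ℝ) (hf : Measurable f) (a b : ℝ) (ha : 0 < a)
    (hfa : ∀ z, a ≤ f z) (hfb : ∀ z, f z ≤ b) (h : ℝ → ℝ) (hh : Measurable h) (M : ℝ)
    (hM : ∀ z, |h z| ≤ M) (c : ℝ) :
    ENNReal.ofReal (((∫ z in Ioi (0:ℝ), f z * Real.exp (-(∫ s in (0:ℝ)..z, f s)) * h z) - c) ^ 2) ≤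
    ∫⁻ z in Ioi (0:ℝ), ENNReal.ofReal (b * Real.exp (-a * z) * (h z - c) ^ 2) := by
  obtain ⟨hlow, hI, h1⟩ := aux_prob f hf a b ha hfa hfb
  set k : ℝ → ℝ := fun z => f z * Real.exp (-(∫ s in (0:ℝ)..z, f s)) with hk
  have hI1 : IntegrableOn (fun z => k z * h z) (Ioi 0) :=
    hI.mul_bdd (c := M) hh.aestronglyMeasurable (Filter.Eventually.of_forall hM)
  have hI2 : IntegrableOn (fun z => k z * h z * h z) (Ioi 0) :=
    hI1.mul_bdd (c := M) hh.aestronglyMeasurable (Filter.Eventually.of_forall hM)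
  set m := ∫ z in Ioi (0:ℝ), k z * h z with hm
  have hk0 : ∀ z, 0 ≤ k z := fun z => mul_nonneg (ha.le.trans (hfa z)) (Real.exp_pos _).le
  have hexpand : ∀ e : ℝ, IntegrableOn (fun z => k z * (h z - e)^2) (Ioi 0) ∧
      ∫ z in Ioi (0:ℝ), k z * (h z - e)^2 = (∫ z in Ioi (0:ℝ), k z * h z * h z) - 2 * e * m + e^2 := by
    intro e
    have he : (fun z => k z * (h z - e)^2) = fun z => (k z * h z * h z - 2 * e * (k z * h z)) + e^2 * k z := by
      ext z; ring
    rw [he]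
    have hS : IntegrableOn (fun z => k z * h z * h z - 2 * e * (k z * h z)) (Ioi 0) :=
      hI2.sub (hI1.const_mul _)
    refine ⟨hS.add (hI.const_mul _), ?_⟩
    rw [integral_add hS (hI.const_mul _),
      integral_sub hI2 (hI1.const_mul _), integral_const_mul, integral_const_mul, h1, mul_one]
  have p0 : 0 ≤ ∫ z in Ioi (0:ℝ), k z * (h z - m)^2 :=
    integral_nonneg fun z => mul_nonneg (hk0 z) (sq_nonneg _)
  have hle : (m - c)^2 ≤ ∫ z in Ioi (0:ℝ), k z * (h z - c)^2 := by
    rw [(hexpand m).2] at p0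
    rw [(hexpand c).2]
    nlinarith
  refine (ENNReal.ofReal_le_ofReal hle).trans ?_
  rw [ofReal_integral_eq_lintegral_ofReal (hexpand c).1
    (Filter.Eventually.of_forall fun z => mul_nonneg (hk0 z) (sq_nonneg _))]
  refine setLIntegral_mono' measurableSet_Ioi fun z hz => ENNReal.ofReal_le_ofReal ?_
  have hz : 0 < z := hz
  refine mul_le_mul_of_nonneg_right ?_ (sq_nonneg _)
  refine mul_le_mul (hfb z) (Real.exp_le_exp.2 ?_) (Real.exp_pos _).le (ha.le.trans ((hfa 0).trans (hfb 0)))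
  linarith [hlow z hz.le]

theorem aux_expint (a b c : ℝ) (ha : 0 < a) (hb : 0 < b) (hc : 0 ≤ c) :
    ∫⁻ z in Ioi (0:ℝ), ENNReal.ofReal (b * Real.exp (-a * z) * min (c * z) 1) ≤
      ENNReal.ofReal (2 * b / a * min (2 * c / a) 1) := by
  have hm : 0 ≤ min (2 * c / a) 1 := le_min (by positivity) zero_le_one
  have hI : IntegrableOn (fun z : ℝ => b * min (2 * c / a) 1 * Real.exp (-(a/2) * z)) (Ioi 0) :=
    (exp_neg_integrableOn_Ioi 0 (half_pos ha)).const_mul _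
  calc _ ≤ ∫⁻ z in Ioi (0:ℝ), ENNReal.ofReal (b * min (2 * c / a) 1 * Real.exp (-(a/2) * z)) := by
        refine setLIntegral_mono' measurableSet_Ioi fun z hz => ENNReal.ofReal_le_ofReal ?_
        have hz : 0 < z := hz
        have e1 : Real.exp (-a * z) = Real.exp (-(a/2) * z) * Real.exp (-(a/2) * z) := by
          rw [← Real.exp_add]; ring_nf
        have e2 : Real.exp (-(a/2) * z) ≤ 1 := Real.exp_le_one_iff.2 (by nlinarith)
        have e3 : Real.exp (-(a/2) * z) * (a / 2 * z) ≤ 1 := by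
          have := Real.add_one_le_exp (a/2*z)
          have h2 : Real.exp (-(a/2) * z) * Real.exp (a/2*z) = 1 := by
            rw [← Real.exp_add]; simp
          nlinarith [Real.exp_pos (-(a/2) * z)]
        have e4 : Real.exp (-(a/2) * z) * min (c * z) 1 ≤ min (2 * c / a) 1 := by
          refine le_min ?_ ?_
          · calc _ ≤ Real.exp (-(a/2) * z) * (c * z) := by gcongr; exact min_le_left _ _
              _ = (2 * c / a) * (Real.exp (-(a/2) * z) * (a / 2 * z)) := by field_simp
              _ ≤ (2 * c / a) * 1 := by gcongr
              _ = _ := mul_one _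
          · calc _ ≤ 1 * (1:ℝ) := mul_le_mul e2 (min_le_right _ _) (le_min (by positivity) zero_le_one) zero_le_one
              _ = 1 := mul_one _
        calc _ = b * Real.exp (-(a/2) * z) * (Real.exp (-(a/2) * z) * min (c * z) 1) := by rw [e1]; ring
          _ ≤ b * Real.exp (-(a/2) * z) * min (2 * c / a) 1 := by gcongr
          _ = _ := by ring
    _ = _ := by
        rw [← ofReal_integral_eq_lintegral_ofReal hI
          (Filter.Eventually.of_forall fun z => by positivity), integral_const_mul,
          integral_exp_mul_Ioi (by linarith)]
        congr 1
        simp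
        field_simp

theorem aux_shift {E : Type*} [NormedAddCommGroup E] [MeasurableSpace E] [BorelSpace E]
    (μ : Measure E) [μ.IsAddRightInvariant] (B : Set E) (hB : MeasurableSet B)
    (g : E → ℝ) (K : ℝ) (hK : 0 ≤ K) (w : E)
    (hg : ∀ x, g x ≤ K) (hg0 : ∀ x, x ∉ B → x + w ∉ B → g x = 0) :
    ∫⁻ x, ENNReal.ofReal (g x) ∂μ ≤ ENNReal.ofReal K * (2 * μ B) := by
  calc _ ≤ ∫⁻ x, (B.indicator (fun _ => ENNReal.ofReal K) x
            + B.indicator (fun _ => ENNReal.ofReal K) (x + w)) ∂μ := by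
        refine lintegral_mono fun x => ?_
        by_cases h1 : x ∈ B
        · rw [indicator_of_mem h1]
          exact (ENNReal.ofReal_le_ofReal (hg x)).trans le_self_add
        · by_cases h2 : x + w ∈ B
          · rw [indicator_of_mem h2]
            exact (ENNReal.ofReal_le_ofReal (hg x)).trans le_add_self
          · simp [hg0 x h1 h2]
    _ = _ := by
        rw [lintegral_add_left (measurable_const.indicator hB),
          lintegral_add_right_eq_self (fun x => B.indicator (fun _ => ENNReal.ofReal K) x) w,
          lintegral_indicator hB, setLIntegral_const]
        ring

theorem aux_integral_le {α : Type*} [MeasurableSpace α] (μ : Measure α) (g : α → ℝ)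
    (hg : ∀ x, 0 ≤ g x) (S : ℝ) (hS : 0 ≤ S)
    (h : ∫⁻ x, ENNReal.ofReal (g x) ∂μ ≤ ENNReal.ofReal S) : ∫ x, g x ∂μ ≤ S := by
  by_cases hi : Integrable g μ
  · rw [← ofReal_integral_eq_lintegral_ofReal hi (Filter.Eventually.of_forall hg)] at h
    exact (ENNReal.ofReal_le_ofReal_iff hS).1 h
  · rw [integral_undef hi]; exact hS

/-- Core estimate at fixed `t` and `v`. -/
theorem aux_core {d : ℕ} (ψ : Euc d → ℝ) (hψ : Continuous ψ) (M C : ℝ) (hC : 0 ≤ C)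
    (hM : ∀ x, |ψ x| ≤ M) (B : Set (Euc d)) (hB : MeasurableSet B) (hBf : volume B ≠ ⊤)
    (hψB : ∀ x, x ∉ B → ψ x = 0)
    (hD : ∀ x w, (ψ (x + w) - ψ x) ^ 2 ≤ C * min ‖w‖ 1)
    (f : Euc d → ℝ) (hf : Measurable f) (a b : ℝ) (ha : 0 < a) (hfa : ∀ x, a ≤ f x)
    (hfb : ∀ x, f x ≤ b) (e : ℝ) (he : 0 ≤ e) (v : Euc d) :
    ∫ x, ((∫ z in Ioi (0:ℝ), f (x + (e * z) • v) *
      Real.exp (-(∫ s in (0:ℝ)..z, f (x + (e * s) • v))) * ψ (x + (e * z) • v)) - ψ x) ^ 2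
      ≤ C * (2 * volume.real B) * (2 * b / a * min (2 * (e * ‖v‖) / a) 1) := by
  have hb : 0 < b := ha.trans_le ((hfa 0).trans (hfb 0))
  have hm : 0 ≤ min (2 * (e * ‖v‖) / a) 1 := le_min (by positivity) zero_le_one
  refine aux_integral_le _ _ (fun x => sq_nonneg _) _ (by positivity) ?_
  calc _ ≤ ∫⁻ x, ∫⁻ z in Ioi (0:ℝ), ENNReal.ofReal
            (b * Real.exp (-a * z) * (ψ (x + (e * z) • v) - ψ x) ^ 2) := by
        refine lintegral_mono fun x => ?_
        have hmeas : Measurable fun z : ℝ => x + (e * z) • v := by fun_prop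
        exact aux_jensen (fun z => f (x + (e * z) • v)) (hf.comp hmeas) a b ha
          (fun z => hfa _) (fun z => hfb _) (fun z => ψ (x + (e * z) • v))
          (hψ.measurable.comp hmeas) M (fun z => hM _) (ψ x)
    _ = ∫⁻ z in Ioi (0:ℝ), ∫⁻ x, ENNReal.ofReal
            (b * Real.exp (-a * z) * (ψ (x + (e * z) • v) - ψ x) ^ 2) := by
        refine lintegral_lintegral_swap ?_
        refine Measurable.aemeasurable (Measurable.ennreal_ofReal (Continuous.measurable ?_))
        fun_prop
    _ ≤ ∫⁻ z in Ioi (0:ℝ), ENNReal.ofReal (b * Real.exp (-a * z) * min ((e * ‖v‖) * z) 1) *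
          (ENNReal.ofReal C * (2 * volume B)) := by
        refine setLIntegral_mono' measurableSet_Ioi fun z hz => ?_
        have hz : 0 < z := hz
        have hw : ‖(e * z) • v‖ = (e * ‖v‖) * z := by
          rw [norm_smul, Real.norm_of_nonneg (by positivity)]; ring
        have hn : 0 ≤ min ((e * ‖v‖) * z) 1 := le_min (by positivity) zero_le_one
        refine (aux_shift volume B hB _ (b * Real.exp (-a * z) * (C * min ((e * ‖v‖) * z) 1))
          (by positivity) ((e * z) • v) ?_ ?_).trans (le_of_eq ?_)
        · intro x
          have := hD x ((e * z) • v)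
          rw [hw] at this
          gcongr
        · intro x h1 h2
          simp [hψB _ h1, hψB _ h2]
        · rw [← mul_assoc (ENNReal.ofReal _) (ENNReal.ofReal C), ← ENNReal.ofReal_mul (by positivity)]
          congr 2
          ring
    _ = (∫⁻ z in Ioi (0:ℝ), ENNReal.ofReal (b * Real.exp (-a * z) * min ((e * ‖v‖) * z) 1)) *
          (ENNReal.ofReal C * (2 * volume B)) := by
        refine lintegral_mul_const _ (Measurable.ennreal_ofReal (Continuous.measurable ?_))
        fun_prop
    _ ≤ ENNReal.ofReal (2 * b / a * min (2 * (e * ‖v‖) / a) 1) *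
          (ENNReal.ofReal C * (2 * volume B)) := by
        gcongr
        exact aux_expint a b _ ha hb (by positivity)
    _ = _ := by
        rw [ENNReal.ofReal_mul (p := C * (2 * volume.real B)) (by positivity),
          ENNReal.ofReal_mul hC, ENNReal.ofReal_mul (by norm_num : (0:ℝ) ≤ 2),
          ofReal_measureReal hBf, mul_comm]
        simp

/-- Facts on the time derivative of a test function. -/
theorem aux_psi {d : ℕ} (φ : ℝ → Euc d → ℝ)
    (hφ : ContDiff ℝ (⊤ : ℕ∞) fun p : ℝ × Euc d => φ p.1 p.2)
    (hφc : HasCompactSupport fun p : ℝ × Euc d => φ p.1 p.2) :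
    ∃ M C T : ℝ, 0 ≤ C ∧ 0 ≤ T ∧
      (∀ t, Continuous fun x => deriv (fun r => φ r x) t) ∧
      (∀ t x, |deriv (fun r => φ r x) t| ≤ M) ∧
      (∀ t x, (T < |t| ∨ x ∉ Metric.closedBall (0 : Euc d) T) → deriv (fun r => φ r x) t = 0) ∧
      (∀ t x w, (deriv (fun r => φ r (x + w)) t - deriv (fun r => φ r x) t) ^ 2
        ≤ C * min ‖w‖ 1) := by
  set Φ : ℝ × Euc d → ℝ := fun p => φ p.1 p.2 with hΦ
  set Ψ : ℝ × Euc d → ℝ := fun p => fderiv ℝ Φ p (1, 0) with hΨ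
  have heq : ∀ t x, deriv (fun r => φ r x) t = Ψ (t, x) := by
    intro t x
    have h1 : HasFDerivAt Φ (fderiv ℝ Φ (t, x)) (t, x) :=
      (hφ.differentiable (by simp) (t, x)).hasFDerivAt
    have h2 : HasDerivAt (fun r : ℝ => (r, x)) ((1 : ℝ), (0 : Euc d)) t :=
      (hasDerivAt_id t).prodMk (hasDerivAt_const t x)
    exact (h1.comp_hasDerivAt t h2).deriv
  have hΨd : ContDiff ℝ 1 Ψ := by
    have : ContDiff ℝ 1 (fderiv ℝ Φ) := hφ.fderiv_right (by norm_cast)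
    exact this.clm_apply contDiff_const
  have hΨc : HasCompactSupport Ψ := by
    refine (hφc.fderiv ℝ).mono ?_
    intro p hp hp'
    apply hp
    simp only [hΨ]
    rw [hp']; rfl
  obtain ⟨M, hM⟩ := hΨc.exists_bound_of_continuous hΨd.continuous
  obtain ⟨L, hL⟩ := ContDiff.lipschitzWith_of_hasCompactSupport hΨc hΨd (by simp)
  obtain ⟨T, hT⟩ := hΨc.isCompact.isBounded.subset_closedBall 0
  have hM0 : 0 ≤ M := (norm_nonneg _).trans (hM 0)
  have hz : ∀ t x, (max T 0 < |t| ∨ x ∉ Metric.closedBall (0 : Euc d) (max T 0)) → Ψ (t, x) = 0 := by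
    intro t x h
    by_contra hne
    have hmem := hT (subset_tsupport _ hne)
    rw [mem_closedBall_zero_iff, Prod.norm_def] at hmem
    have h1 := (le_max_left _ _).trans hmem
    have h2 := (le_max_right _ _).trans hmem
    simp only [Real.norm_eq_abs] at h1 h2
    rcases h with h | h
    · exact absurd (lt_of_le_of_lt (le_max_left T 0) h) (not_lt.2 h1)
    · exact h (mem_closedBall_zero_iff.2 (h2.trans (le_max_left _ _)))
  simp only [heq]
  refine ⟨M, 2 * M * max (L : ℝ) (2 * M), max T 0, by positivity, le_max_right _ _, ?_, ?_, hz, ?_⟩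
  · intro t
    exact hΨd.continuous.comp (by fun_prop)
  · intro t x; exact hM (t, x)
  · intro t x w
    have d1 : |Ψ (t, x + w) - Ψ (t, x)| ≤ L * ‖w‖ := by
      have := hL.dist_le_mul (t, x + w) (t, x)
      rw [Real.dist_eq, Prod.dist_eq] at this
      simpa using this
    have d2 : |Ψ (t, x + w) - Ψ (t, x)| ≤ 2 * M := by
      have h1 := hM (t, x + w)
      have h2 := hM (t, x)
      rw [Real.norm_eq_abs] at h1 h2
      calc _ ≤ |Ψ (t, x + w)| + |Ψ (t, x)| := abs_sub _ _
        _ ≤ _ := by linarith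
    have d3 : |Ψ (t, x + w) - Ψ (t, x)| ≤ max (L : ℝ) (2 * M) * min ‖w‖ 1 := by
      rw [mul_min_of_nonneg _ _ (by positivity)]
      refine le_min (d1.trans ?_) (d2.trans ?_)
      · gcongr; exact le_max_left _ _
      · rw [mul_one]; exact le_max_right _ _
    have hmn : 0 ≤ min ‖w‖ (1:ℝ) := le_min (norm_nonneg _) zero_le_one
    rw [← sq_abs, sq]
    calc _ ≤ (2 * M) * (max (L : ℝ) (2 * M) * min ‖w‖ 1) := mul_le_mul d2 d3 (abs_nonneg _) (by positivity)
      _ = _ := by ring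

/-- Strong `L²_F` convergence of the time derivative of the auxiliary solution:
`∫₀^∞ ∫∫ F(v) (∂_t χ^ε − ∂_t φ)² dx dv dt → 0` as `ε → 0⁺`, where `∂_t χ^ε` is obtained by
replacing `φ` by `∂_t φ` in the explicit formula for `χ^ε`. -/
theorem chiAux_time_derivative_L2F_convergence (d : ℕ) (hd : 1 ≤ d)
    (β ν₁ ν₂ : ℝ) (hβ : β < 1) (hν₁ : 0 < ν₁) (h12 : ν₁ ≤ ν₂)
    (ν : Euc d → Euc d → ℝ)
    (hν_meas : Measurable fun p : Euc d × Euc d => ν p.1 p.2)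
    (hν_bound : ∀ x v, ν₁ * Real.sqrt (1 + ‖v‖ ^ 2) ^ β ≤ ν x v ∧
      ν x v ≤ ν₂ * Real.sqrt (1 + ‖v‖ ^ 2) ^ β)
    (F : Euc d → ℝ) (hF_pos : ∀ v, 0 < F v) (hF_meas : Measurable F)
    (hF_int : Integrable F) (hF_mass : (∫ v, F v) = 1)
    (φ : ℝ → Euc d → ℝ)
    (hφ : ContDiff ℝ (⊤ : ℕ∞) fun p : ℝ × Euc d => φ p.1 p.2)
    (hφc : HasCompactSupport fun p : ℝ × Euc d => φ p.1 p.2) :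
    Filter.Tendsto
      (fun ε => ∫ t in Set.Ioi (0 : ℝ), ∫ v, ∫ x,
        F v * (chiAux ν β (fun s y => deriv (fun r => φ r y) s) ε t x v
          - deriv (fun r => φ r x) t) ^ 2)
      (nhdsWithin 0 (Set.Ioi 0)) (nhds 0) := by
  obtain ⟨M, C, T, hC, hT, hcont, hM, hzero, hD⟩ := aux_psi φ hφ hφc
  set ψ : ℝ → Euc d → ℝ := fun s y => deriv (fun r => φ r y) s with hψ
  set q : Euc d → ℝ := fun v => Real.sqrt (1 + ‖v‖ ^ 2) ^ β with hq
  have hqpos : ∀ v, 0 < q v := fun v => Real.rpow_pos_of_pos (Real.sqrt_pos.2 (by positivity)) _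
  have hqm : Measurable q := by
    refine Measurable.pow_const ?_ β
    fun_prop
  have hν₂ : 0 < ν₂ := hν₁.trans_le h12
  have hj : ∀ v : Euc d, 0 < jfloor (-β) v := by
    intro v
    unfold jfloor
    split_ifs with h
    · exact one_pos
    · exact Real.rpow_pos_of_pos (by linarith) _
  set K : Euc d → ℝ := fun v => 2 * ‖v‖ / (ν₁ * q v) with hK
  have hKm : Measurable K := by
    refine Measurable.div (by fun_prop) (hqm.const_mul _)
  have hK0 : ∀ v, 0 ≤ K v := fun v => by have := hqpos v; positivity
  set V : ℝ := volume.real (Metric.closedBall (0 : Euc d) T) with hV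
  set C' : ℝ := C * (2 * V) * (2 * ν₂ / ν₁) with hC'
  have hC'0 : 0 ≤ C' := by positivity
  -- the estimate in `x`
  have hx : ∀ ε, 0 < ε → ∀ t v, ∫ x, (chiAux ν β ψ ε t x v - ψ t x) ^ 2 ≤ C' * min (ε * K v) 1 := by
    intro ε hε t v
    have hjv := hj v
    have hqv := hqpos v
    have h := aux_core (ψ t) (hcont t) M C hC (hM t) (Metric.closedBall (0 : Euc d) T)
      measurableSet_closedBall measure_closedBall_lt_top.ne
      (fun x hx => hzero t x (Or.inr hx)) (hD t)
      (fun y => jfloor (-β) v * ν y v)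
      ((hν_meas.comp (measurable_id.prodMk measurable_const)).const_mul _)
      (jfloor (-β) v * (ν₁ * q v)) (jfloor (-β) v * (ν₂ * q v)) (by positivity)
      (fun y => mul_le_mul_of_nonneg_left (hν_bound y v).1 hjv.le)
      (fun y => mul_le_mul_of_nonneg_left (hν_bound y v).2 hjv.le)
      (ε * jfloor (-β) v) (by positivity) v
    refine h.trans (le_of_eq ?_)
    have e1 : 2 * (jfloor (-β) v * (ν₂ * q v)) / (jfloor (-β) v * (ν₁ * q v)) = 2 * ν₂ / ν₁ := by
      field_simp
    have e2 : 2 * (ε * jfloor (-β) v * ‖v‖) / (jfloor (-β) v * (ν₁ * q v)) = ε * K v := by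
      simp only [hK]
      field_simp
    rw [e1, e2, hC', hV]
    ring
  have hx0 : ∀ ε t, T < |t| → ∀ v x, chiAux ν β ψ ε t x v - ψ t x = 0 := by
    intro ε t ht v x
    have : ∀ y, ψ t y = 0 := fun y => hzero t y (Or.inl ht)
    simp [chiAux, this]
  set I : ℝ → ℝ := fun ε => ∫ v, F v * (C' * min (ε * K v) 1) with hI
  have hbd : ∀ ε, 0 < ε → ∀ v, ‖F v * (C' * min (ε * K v) 1)‖ ≤ F v * C' := by
    intro ε hε v
    have hn : 0 ≤ min (ε * K v) 1 := le_min (mul_nonneg hε.le (hK0 v)) zero_le_one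
    have := (hF_pos v).le
    rw [Real.norm_of_nonneg (by positivity)]
    have : C' * min (ε * K v) 1 ≤ C' * 1 := by gcongr; exact min_le_right _ _
    rw [mul_one] at this
    gcongr
  have hmeasI : ∀ ε, Measurable fun v => F v * (C' * min (ε * K v) 1) := fun ε =>
    hF_meas.mul (((hKm.const_mul ε).min measurable_const).const_mul C')
  have hIint : ∀ ε, 0 < ε → Integrable (fun v => F v * (C' * min (ε * K v) 1)) := fun ε hε =>
    Integrable.mono' (hF_int.mul_const C') (hmeasI ε).aestronglyMeasurable
      (Filter.Eventually.of_forall (hbd ε hε))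
  have hpos : ∀ᶠ ε : ℝ in nhdsWithin 0 (Ioi 0), 0 < ε := self_mem_nhdsWithin
  have hIlim : Filter.Tendsto I (nhdsWithin 0 (Ioi 0)) (nhds 0) := by
    have h0 : (0:ℝ) = ∫ v : Euc d, F v * (C' * min (0 * K v) 1) := by simp
    suffices hs : Filter.Tendsto I (nhdsWithin 0 (Ioi 0))
        (nhds (∫ v : Euc d, F v * (C' * min (0 * K v) 1))) by
      rwa [← h0] at hs
    refine tendsto_integral_filter_of_dominated_convergence (fun v => F v * C') ?_ ?_
      (hF_int.mul_const C') ?_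
    · exact Filter.Eventually.of_forall fun ε => (hmeasI ε).aestronglyMeasurable
    · filter_upwards [hpos] with ε hε using Filter.Eventually.of_forall (hbd ε hε)
    · refine Filter.Eventually.of_forall fun v => ?_
      have hc : Continuous fun ε : ℝ => F v * (C' * min (ε * K v) 1) := by fun_prop
      exact (hc.tendsto 0).mono_left nhdsWithin_le_nhds
  have hv0 : ∀ ε t v, 0 ≤ ∫ x, F v * (chiAux ν β ψ ε t x v - ψ t x) ^ 2 := fun ε t v =>
    integral_nonneg fun x => mul_nonneg (hF_pos v).le (sq_nonneg _)
  have ht0 : ∀ ε t, 0 ≤ ∫ v, ∫ x, F v * (chiAux ν β ψ ε t x v - ψ t x) ^ 2 := fun ε t =>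
    integral_nonneg fun v => hv0 ε t v
  have hv : ∀ ε, 0 < ε → ∀ t, ∫ v, ∫ x, F v * (chiAux ν β ψ ε t x v - ψ t x) ^ 2 ≤ I ε := by
    intro ε hε t
    refine integral_mono_of_nonneg (Filter.Eventually.of_forall fun v => hv0 ε t v) (hIint ε hε)
      (Filter.Eventually.of_forall fun v => ?_)
    simp only
    rw [integral_const_mul]
    exact mul_le_mul_of_nonneg_left (hx ε hε t v) (hF_pos v).le
  have ht : ∀ ε, 0 < ε → ∫ t in Ioi (0:ℝ), ∫ v, ∫ x, F v * (chiAux ν β ψ ε t x v - ψ t x) ^ 2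
      ≤ T * I ε := by
    intro ε hε
    have hInd : Integrable ((Ioc (0:ℝ) T).indicator fun _ => I ε) (volume.restrict (Ioi 0)) := by
      refine Integrable.restrict ?_
      exact (integrable_indicator_iff measurableSet_Ioc).2 (integrableOn_const (by simp))
    refine (integral_mono_of_nonneg (Filter.Eventually.of_forall fun t => ht0 ε t) hInd ?_).trans ?_
    · refine (ae_restrict_iff' measurableSet_Ioi).2 (Filter.Eventually.of_forall fun t htp => ?_)
      have htp : 0 < t := htp
      by_cases h : t ≤ T
      · rw [indicator_of_mem (show t ∈ Ioc 0 T from ⟨htp, h⟩)]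
        exact hv ε hε t
      · rw [indicator_of_notMem (fun hh => h hh.2)]
        have := hx0 ε t (by rw [abs_of_pos htp]; exact not_le.1 h)
        simp [this]
    · rw [integral_indicator measurableSet_Ioc, Measure.restrict_restrict measurableSet_Ioc,
        inter_eq_left.2 Ioc_subset_Ioi_self]
      simp [hT]
  refine tendsto_of_tendsto_of_tendsto_of_le_of_le' (g := fun _ => (0:ℝ)) (h := fun ε => T * I ε)
    tendsto_const_nhds (by simpa using hIlim.const_mul T) ?_ ?_
  · exact Filter.Eventually.of_forall fun ε => integral_nonneg fun t => ht0 ε t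
  · filter_upwards [hpos] with ε hε using ht ε hε
end
end

section
/- Uniform L²_F bounds for the auxiliary solution: let F : ℝ^d → (0,∞) be measurable with ∫_{ℝ^d} F(v) dv = 1. Then for every ε > 0, ∫₀^∞ ∫_{ℝ^d} ∫_{ℝ^d} F(v) |χ^ε(t,x,v)|² dx dv dt ≤ (ν₂/ν₁) ∫₀^∞ ∫_{ℝ^d} |φ(t,x)|² dx dt, and likewise ∫₀^∞ ∫_{ℝ^d} ∫_{ℝ^d} F(v) |∂_t χ^ε(t,x,v)|² dx dv dt ≤ (ν₂/ν₁) ∫₀^∞ ∫_{ℝ^d} |∂_t φ(t,x)|² dx dt. -/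
open MeasureTheory Set

noncomputable section

theorem aux_weight {g : ℝ → ℝ} {c1 c2 : ℝ} (hc1 : 0 < c1) (hg : Measurable g)
    (h1 : ∀ z, c1 ≤ g z) (h2 : ∀ z, g z ≤ c2) :
    IntegrableOn (fun z => g z * Real.exp (-(∫ s in (0 : ℝ)..z, g s))) (Ioi 0) ∧
    (∫ z in Ioi (0 : ℝ), g z * Real.exp (-(∫ s in (0 : ℝ)..z, g s))) ≤ 1 ∧
    (∀ z, 0 < z → g z * Real.exp (-(∫ s in (0 : ℝ)..z, g s)) ≤ c2 * Real.exp (-c1 * z)) := by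
  have hbd : ∀ z, ‖g z‖ ≤ c2 := fun z => by
    rw [Real.norm_eq_abs, abs_of_nonneg (hc1.le.trans (h1 z))]; exact h2 z
  have hloc : LocallyIntegrable g volume := by
    have h : LocallyIntegrable (fun _ : ℝ => c2) volume := locallyIntegrable_const c2
    refine h.mono hg.aestronglyMeasurable ?_
    filter_upwards with z
    exact (hbd z).trans (le_abs_self _)
  have hii : ∀ a b, IntervalIntegrable g volume a b := fun a b =>
    intervalIntegrable_iff.mpr
      ((LocallyIntegrable.integrableOn_isCompact hloc isCompact_uIcc).mono_set uIoc_subset_uIcc)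
  set G : ℝ → ℝ := fun z => ∫ s in (0 : ℝ)..z, g s with hG
  have hGc : Continuous G := intervalIntegral.continuous_primitive hii 0
  have hGm : Monotone G := by
    intro a b hab
    have : G b - G a = ∫ s in a..b, g s :=
      intervalIntegral.integral_interval_sub_left (hii _ _) (hii _ _)
    have h3 : 0 ≤ ∫ s in a..b, g s :=
      intervalIntegral.integral_nonneg hab (fun u _ => hc1.le.trans (h1 u))
    linarith
  have hGl : ∀ z, 0 < z → c1 * z ≤ G z := by
    intro z hz
    have := intervalIntegral.integral_mono_on (a := 0) (b := z) (f := fun _ => c1) (g := g) (μ := volume) hz.le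
      (by simp) (hii _ _) (fun x _ => h1 x)
    simp at this
    rw [mul_comm]; exact this
  have hle : ∀ z, 0 < z → g z * Real.exp (-(G z)) ≤ c2 * Real.exp (-c1 * z) := by
    intro z hz
    have := hGl z hz
    exact mul_le_mul (h2 z) (Real.exp_le_exp.2 (by linarith)) (Real.exp_pos _).le
      (hc1.le.trans ((h1 z).trans (h2 z)))
  have hint : IntegrableOn (fun z => g z * Real.exp (-(G z))) (Ioi 0) := by
    have hdom : IntegrableOn (fun z => c2 * Real.exp (-c1 * z)) (Ioi 0) :=
      (exp_neg_integrableOn_Ioi 0 hc1).const_mul c2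
    refine Integrable.mono' hdom ?_ ?_
    · exact (hg.mul (Real.measurable_exp.comp hGc.measurable.neg)).aestronglyMeasurable
    · filter_upwards [ae_restrict_mem measurableSet_Ioi] with z hz
      rw [Real.norm_eq_abs, abs_of_nonneg (mul_nonneg (hc1.le.trans (h1 z)) (Real.exp_pos _).le)]
      exact hle z hz
  refine ⟨hint, ?_, hle⟩
  refine le_of_tendsto (intervalIntegral_tendsto_integral_Ioi 0 hint Filter.tendsto_id) ?_
  filter_upwards [Filter.eventually_ge_atTop (0 : ℝ)] with b hb
  have hH : Monotone (fun z => - Real.exp (-(G z))) := by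
    intro a b hab
    exact neg_le_neg (Real.exp_le_exp.2 (neg_le_neg (hGm hab)))
  have hmem := (hH.monotoneOn (uIcc 0 b)).intervalIntegral_deriv_mem_uIcc
  have hG0 : G 0 = 0 := by simp [hG]
  rw [uIcc_of_le (sub_nonneg.2 (hH hb))] at hmem
  have h3 := hmem.2
  have heq : ∫ x in (0 : ℝ)..b, deriv (fun z => - Real.exp (-(G z))) x
      = ∫ x in (0 : ℝ)..id b, g x * Real.exp (-(G x)) := by
    refine intervalIntegral.integral_congr_ae ?_
    filter_upwards [LocallyIntegrable.ae_hasDerivAt_integral hloc] with x hx _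
    have := ((hx 0).fun_neg.exp).fun_neg
    rw [this.deriv]
    simp only [hG]; ring
  rw [← heq]
  simp only [hG0, neg_zero, Real.exp_zero] at h3
  have := Real.exp_pos (-(G b))
  linarith

theorem aux_jensen_s11 {w f : ℝ → ℝ} {C : ℝ} {μ : Measure ℝ} (hw : Integrable w μ)
    (hw0 : ∀ᵐ z ∂μ, 0 ≤ w z)
    (hw1 : ∫ z, w z ∂μ ≤ 1) (hf : Measurable f) (hC : ∀ z, |f z| ≤ C) :
    Integrable (fun z => w z * f z ^ 2) μ ∧
    (∫ z, w z * f z ∂μ) ^ 2 ≤ ∫ z, w z * f z ^ 2 ∂μ := by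
  have i1 : Integrable (fun z => w z * f z) μ :=
    hw.mul_bdd hf.aestronglyMeasurable (Filter.Eventually.of_forall hC)
  have i2 : Integrable (fun z => w z * f z ^ 2) μ :=
    hw.mul_bdd (c := C ^ 2) (hf.pow_const 2).aestronglyMeasurable (Filter.Eventually.of_forall
      (fun z => by
        rw [Real.norm_eq_abs, abs_pow]
        exact pow_le_pow_left₀ (abs_nonneg _) (hC z) 2))
  refine ⟨i2, ?_⟩
  set A := ∫ z, w z * f z ∂μ with hA
  have h0 : 0 ≤ ∫ z, w z * (f z - A) ^ 2 ∂μ := by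
    refine integral_nonneg_of_ae ?_
    filter_upwards [hw0] with z hz
    exact mul_nonneg hz (sq_nonneg _)
  have he : ∫ z, w z * (f z - A) ^ 2 ∂μ
      = (∫ z, w z * f z ^ 2 ∂μ) - (2 * A) * A + A ^ 2 * ∫ z, w z ∂μ := by
    have : ∀ z, w z * (f z - A) ^ 2
        = w z * f z ^ 2 - (2 * A) * (w z * f z) + A ^ 2 * w z := fun z => by ring
    simp_rw [this]
    have i3 : Integrable (fun z => w z * f z ^ 2 - (2 * A) * (w z * f z)) μ :=
      i2.sub (i1.const_mul _)
    rw [integral_add i3 (hw.const_mul _),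
      integral_sub i2 (i1.const_mul _), integral_const_mul, integral_const_mul]
  nlinarith [sq_nonneg A]

theorem aux_x {d : ℕ} {w : Euc d → ℝ → ℝ} {c1 c2 k : ℝ} (hc1 : 0 < c1) (v : Euc d)
    (hwi : ∀ x, IntegrableOn (w x) (Ioi 0))
    (hw0 : ∀ x z, 0 ≤ w x z)
    (hw1 : ∀ x, (∫ z in Ioi (0 : ℝ), w x z) ≤ 1)
    (hw2 : ∀ x z, 0 < z → w x z ≤ c2 * Real.exp (-c1 * z))
    {ψ : Euc d → ℝ} (hψ : Continuous ψ) (hψc : HasCompactSupport ψ) :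
    (∫ x, (∫ z in Ioi (0 : ℝ), w x z * ψ (x + (k * z) • v)) ^ 2)
      ≤ c2 / c1 * ∫ x, ψ x ^ 2 := by
  obtain ⟨C, hC⟩ := hψc.exists_bound_of_continuous hψ
  have hsq : Integrable (fun x => ψ x ^ 2) := by
    refine (hψ.pow 2).integrable_of_hasCompactSupport ?_
    refine hψc.mono (fun x hx => ?_)
    intro h0
    exact hx (by simp [h0])
  have hE : IntegrableOn (fun z : ℝ => c2 * Real.exp (-c1 * z)) (Ioi 0) :=
    (exp_neg_integrableOn_Ioi 0 hc1).const_mul c2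
  let h : Euc d → ℝ → ℝ := fun x z => c2 * Real.exp (-c1 * z) * ψ (x + (k * z) • v) ^ 2
  have hcont : Continuous (Function.uncurry h) := by
    unfold h Function.uncurry
    fun_prop
  have hint : Integrable (Function.uncurry h) (volume.prod (volume.restrict (Ioi (0 : ℝ)))) := by
    rw [integrable_prod_iff' hcont.aestronglyMeasurable]
    refine ⟨Filter.Eventually.of_forall fun z => ?_, ?_⟩
    · simp only [Function.uncurry, h]
      exact (hsq.comp_add_right ((k * z) • v)).const_mul (c2 * Real.exp (-c1 * z))
    · have : ∀ z, ∫ x, ‖Function.uncurry h (x, z)‖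
          = ‖c2 * Real.exp (-c1 * z)‖ * ∫ x, ψ x ^ 2 := by
        intro z
        simp only [Function.uncurry, h, norm_mul _ (ψ _ ^ 2)]
        rw [integral_const_mul]
        congr 1
        rw [← integral_add_right_eq_self (fun x => ψ x ^ 2) ((k * z) • v)]
        refine integral_congr_ae (Filter.Eventually.of_forall fun x => ?_)
        simp
      simp_rw [this]
      exact hE.norm.mul_const _
  have hdom : ∀ x, (∫ z in Ioi (0 : ℝ), w x z * ψ (x + (k * z) • v)) ^ 2
      ≤ ∫ z in Ioi (0 : ℝ), h x z := by
    intro x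
    have hfm : Continuous (fun z : ℝ => ψ (x + (k * z) • v)) := by fun_prop
    obtain ⟨j1, j2⟩ := aux_jensen_s11 (f := fun z : ℝ => ψ (x + (k * z) • v)) (C := C) (hwi x)
      (Filter.Eventually.of_forall (hw0 x)) (hw1 x) hfm.measurable (fun z => hC _)
    refine j2.trans ?_
    have hi : IntegrableOn (h x) (Ioi 0) := by
      refine hE.mul_bdd (c := C ^ 2) (hfm.pow 2).aestronglyMeasurable
        (Filter.Eventually.of_forall (fun z => ?_))
      rw [norm_pow]
      exact pow_le_pow_left₀ (norm_nonneg _) (hC _) 2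
    refine setIntegral_mono_on j1 hi measurableSet_Ioi (fun z hz => ?_)
    exact mul_le_mul_of_nonneg_right (hw2 x z hz) (sq_nonneg _)
  calc _ ≤ ∫ x, ∫ z in Ioi (0 : ℝ), h x z :=
        integral_mono_of_nonneg (Filter.Eventually.of_forall fun x => sq_nonneg _)
          hint.integral_prod_left (Filter.Eventually.of_forall hdom)
    _ = ∫ z in Ioi (0 : ℝ), ∫ x, h x z := integral_integral_swap hint
    _ = ∫ z in Ioi (0 : ℝ), (c2 * Real.exp (-c1 * z)) * ∫ x, ψ x ^ 2 := by
        congr 1; ext z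
        simp only [h]
        rw [integral_const_mul, integral_add_right_eq_self (fun x => ψ x ^ 2) ((k * z) • v)]
    _ = c2 / c1 * ∫ x, ψ x ^ 2 := by
        rw [integral_mul_const, integral_const_mul, integral_exp_mul_Ioi (by linarith)]
        simp [div_eq_mul_inv]

theorem aux_v {d : ℕ} (β ν₁ ν₂ : ℝ) (hν₁ : 0 < ν₁)
    (ν : Euc d → Euc d → ℝ)
    (hν_meas : Measurable fun p : Euc d × Euc d => ν p.1 p.2)
    (hν_bound : ∀ x v, ν₁ * Real.sqrt (1 + ‖v‖ ^ 2) ^ β ≤ ν x v ∧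
      ν x v ≤ ν₂ * Real.sqrt (1 + ‖v‖ ^ 2) ^ β)
    (φ : ℝ → Euc d → ℝ) (t : ℝ)
    (hφ : Continuous (φ t)) (hφc : HasCompactSupport (φ t)) (ε : ℝ) (v : Euc d) :
    (∫ x, (chiAux ν β φ ε t x v) ^ 2) ≤ ν₂ / ν₁ * ∫ x, (φ t x) ^ 2 := by
  have ha : 0 < jfloor (-β) v := by
    unfold jfloor
    split_ifs with h
    · exact one_pos
    · exact Real.rpow_pos_of_pos (by linarith) _
  set a := jfloor (-β) v with hadef
  set J := Real.sqrt (1 + ‖v‖ ^ 2) ^ β with hJ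
  have hJ0 : 0 < J := Real.rpow_pos_of_pos (Real.sqrt_pos.2 (by positivity)) _
  have hc1 : 0 < a * (ν₁ * J) := by positivity
  have hgm : ∀ x : Euc d, Measurable (fun z : ℝ => a * ν (x + (ε * a * z) • v) v) := by
    intro x
    have hc : Continuous (fun z : ℝ => (x + (ε * a * z) • v, v)) := by fun_prop
    exact (hν_meas.comp hc.measurable).const_mul a
  have hg1 : ∀ (x : Euc d) (z : ℝ), a * (ν₁ * J) ≤ a * ν (x + (ε * a * z) • v) v :=
    fun x z => mul_le_mul_of_nonneg_left (hν_bound _ v).1 ha.le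
  have hg2 : ∀ (x : Euc d) (z : ℝ), a * ν (x + (ε * a * z) • v) v ≤ a * (ν₂ * J) :=
    fun x z => mul_le_mul_of_nonneg_left (hν_bound _ v).2 ha.le
  have key := fun x => aux_weight hc1 (hgm x) (hg1 x) (hg2 x)
  have := aux_x (k := ε * a) hc1 v (fun x => (key x).1)
    (fun x z => mul_nonneg (hc1.le.trans (hg1 x z)) (Real.exp_pos _).le)
    (fun x => (key x).2.1) (fun x => (key x).2.2) hφ hφc
  have hq : a * (ν₂ * J) / (a * (ν₁ * J)) = ν₂ / ν₁ := by
    field_simp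
  rw [hq] at this
  exact this

theorem aux_main {d : ℕ} (β ν₁ ν₂ : ℝ) (hν₁ : 0 < ν₁)
    (ν : Euc d → Euc d → ℝ)
    (hν_meas : Measurable fun p : Euc d × Euc d => ν p.1 p.2)
    (hν_bound : ∀ x v, ν₁ * Real.sqrt (1 + ‖v‖ ^ 2) ^ β ≤ ν x v ∧
      ν x v ≤ ν₂ * Real.sqrt (1 + ‖v‖ ^ 2) ^ β)
    (F : Euc d → ℝ) (hF_pos : ∀ v, 0 < F v)
    (hF_int : Integrable F) (hF_mass : (∫ v, F v) = 1)
    (φ : ℝ → Euc d → ℝ)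
    (hφ : Continuous fun p : ℝ × Euc d => φ p.1 p.2)
    (hφc : HasCompactSupport fun p : ℝ × Euc d => φ p.1 p.2) (ε : ℝ) :
    (∫ t in Set.Ioi (0 : ℝ), ∫ v, ∫ x, F v * (chiAux ν β φ ε t x v) ^ 2)
        ≤ ν₂ / ν₁ * ∫ t in Set.Ioi (0 : ℝ), ∫ x, (φ t x) ^ 2 := by
  have hφt : ∀ t, Continuous (φ t) := fun t =>
    hφ.comp (by fun_prop : Continuous fun x : Euc d => (t, x))
  have hφtc : ∀ t, HasCompactSupport (φ t) := fun t => by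
    refine HasCompactSupport.intro (hφc.isCompact.image continuous_snd) (fun x hx => ?_)
    by_contra hne
    exact hx ⟨(t, x), subset_tsupport _ hne, rfl⟩
  have hsq : Integrable (fun p : ℝ × Euc d => φ p.1 p.2 ^ 2) (volume.prod volume) := by
    refine (hφ.pow 2).integrable_of_hasCompactSupport ?_
    refine hφc.mono (fun x hx => ?_)
    intro h0
    exact hx (by simpa using h0)
  have hN : Integrable (fun t => ∫ x, φ t x ^ 2) := hsq.integral_prod_left
  rw [← integral_const_mul]
  refine integral_mono_of_nonneg (Filter.Eventually.of_forall fun t => ?_)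
    (hN.integrableOn.const_mul _) (Filter.Eventually.of_forall fun t => ?_)
  · exact integral_nonneg fun v => integral_nonneg fun x =>
      mul_nonneg (hF_pos v).le (sq_nonneg _)
  · have : (∫ v, ∫ x, F v * (chiAux ν β φ ε t x v) ^ 2)
        ≤ ∫ v, F v * (ν₂ / ν₁ * ∫ x, φ t x ^ 2) := by
      refine integral_mono_of_nonneg (Filter.Eventually.of_forall fun v => ?_)
        (hF_int.mul_const _) (Filter.Eventually.of_forall fun v => ?_)
      · exact integral_nonneg fun x => mul_nonneg (hF_pos v).le (sq_nonneg _)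
      · simp only [integral_const_mul]
        exact mul_le_mul_of_nonneg_left
          (aux_v β ν₁ ν₂ hν₁ ν hν_meas hν_bound φ t (hφt t) (hφtc t) ε v) (hF_pos v).le
    rw [integral_mul_const, hF_mass, one_mul] at this
    exact this

/-- Uniform `L²_F` bounds for the auxiliary solution and for its time derivative
(the latter obtained by replacing `φ` with `∂_t φ` in the formula for `χ^ε`). -/
theorem chiAux_uniform_L2F_bounds (d : ℕ) (hd : 1 ≤ d)
    (β ν₁ ν₂ : ℝ) (hβ : β < 1) (hν₁ : 0 < ν₁) (h12 : ν₁ ≤ ν₂)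
    (ν : Euc d → Euc d → ℝ)
    (hν_meas : Measurable fun p : Euc d × Euc d => ν p.1 p.2)
    (hν_bound : ∀ x v, ν₁ * Real.sqrt (1 + ‖v‖ ^ 2) ^ β ≤ ν x v ∧
      ν x v ≤ ν₂ * Real.sqrt (1 + ‖v‖ ^ 2) ^ β)
    (F : Euc d → ℝ) (hF_pos : ∀ v, 0 < F v) (hF_meas : Measurable F)
    (hF_int : Integrable F) (hF_mass : (∫ v, F v) = 1)
    (φ : ℝ → Euc d → ℝ)
    (hφ : ContDiff ℝ (⊤ : ℕ∞) fun p : ℝ × Euc d => φ p.1 p.2)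
    (hφc : HasCompactSupport fun p : ℝ × Euc d => φ p.1 p.2)
    (ε : ℝ) (hε : 0 < ε) :
    (∫ t in Set.Ioi (0 : ℝ), ∫ v, ∫ x, F v * (chiAux ν β φ ε t x v) ^ 2)
        ≤ ν₂ / ν₁ * ∫ t in Set.Ioi (0 : ℝ), ∫ x, (φ t x) ^ 2
      ∧ (∫ t in Set.Ioi (0 : ℝ), ∫ v, ∫ x,
            F v * (chiAux ν β (fun s y => deriv (fun r => φ r y) s) ε t x v) ^ 2)
        ≤ ν₂ / ν₁ * ∫ t in Set.Ioi (0 : ℝ), ∫ x, (deriv (fun r => φ r x) t) ^ 2 := by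
  have hd' : ∀ t x, deriv (fun r => φ r x) t
      = fderiv ℝ (fun p : ℝ × Euc d => φ p.1 p.2) (t, x) (1, 0) := by
    intro t x
    have h1 : HasFDerivAt (fun p : ℝ × Euc d => φ p.1 p.2)
        (fderiv ℝ (fun p : ℝ × Euc d => φ p.1 p.2) (t, x)) (t, x) :=
      (hφ.differentiable (by simp) (t, x)).hasFDerivAt
    have h2 : HasDerivAt (fun r : ℝ => (r, x)) ((1 : ℝ), (0 : Euc d)) t :=
      (hasDerivAt_id t).prodMk (hasDerivAt_const t x)
    exact (h1.comp_hasDerivAt t h2).deriv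
  refine ⟨aux_main β ν₁ ν₂ hν₁ ν hν_meas hν_bound F hF_pos hF_int hF_mass φ hφ.continuous hφc ε,
    aux_main β ν₁ ν₂ hν₁ ν hν_meas hν_bound F hF_pos hF_int hF_mass
      (fun s y => deriv (fun r => φ r y) s) ?_ ?_ ε⟩
  · simp only [hd']
    exact (hφ.continuous_fderiv (by simp)).clm_apply continuous_const
  · simp only [hd']
    exact hφc.fderiv_apply (𝕜 := ℝ) (1, 0)
end
end

section
/- Small velocities do not contribute (Lemma 3.4): assume x ↦ ν(x,v) is C¹ with sup_{x,v} ⟨v⟩^{−β}|∇_x ν(x,v)| ≤ C_ν, and let F : ℝ^d → (0,∞) be measurable with ∫_{ℝ^d} F dv = 1. Then for every R > 0 there is a constant C₀ > 0, depending only on d, β, ν₁, ν₂, C_ν and R, such that for all ε ∈ (0,1), t ≥ 0 and x ∈ ℝ^d, | ∫_{|v| ≤ R} ν(x,v) F(v) [ χ^ε(t,x,v) − φ(t,x) − ε (v/ν(x,v))·∇_x φ(t,x) ] dv | ≤ C₀ ε² ‖φ‖_{W^{2,∞}}. -/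
open MeasureTheory Set

noncomputable section

lemma aux_one_dim (a a1 g g1 g2 : ℝ → ℝ) (m M P K Q S : ℝ) (hm : 0 < m)
    (ha : ∀ z, HasDerivAt a (a1 z) z) (hg : ∀ z, HasDerivAt g (g1 z) z)
    (hg1 : ∀ z, HasDerivAt g1 (g2 z) z) (ca1 : Continuous a1) (cg2 : Continuous g2)
    (hma : ∀ z, m ≤ a z) (haM : ∀ z, a z ≤ M) (hP : ∀ z, |a1 z| ≤ P)
    (hK : ∀ z, |g z| ≤ K) (hQ : ∀ z, |g1 z| ≤ Q) (hS : ∀ z, |g2 z| ≤ S) :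
    |(∫ z in Set.Ioi (0 : ℝ), a z * Real.exp (-(∫ s in (0 : ℝ)..z, a s)) * g z)
      - g 0 - g1 0 / a 0| ≤ (S / m + Q * P / m ^ 2) / m := by
  have ca : Continuous a := continuous_iff_continuousAt.2 fun z => (ha z).continuousAt
  have cg : Continuous g := continuous_iff_continuousAt.2 fun z => (hg z).continuousAt
  have cg1 : Continuous g1 := continuous_iff_continuousAt.2 fun z => (hg1 z).continuousAt
  have hapos : ∀ z, 0 < a z := fun z => hm.trans_le (hma z)
  have hK0 : 0 ≤ K := (abs_nonneg _).trans (hK 0)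
  have hQ0 : 0 ≤ Q := (abs_nonneg _).trans (hQ 0)
  have hS0 : 0 ≤ S := (abs_nonneg _).trans (hS 0)
  have hP0 : 0 ≤ P := (abs_nonneg _).trans (hP 0)
  have hM0 : 0 ≤ M := (hapos 0).le.trans (haM 0)
  set A : ℝ → ℝ := fun z => ∫ s in (0 : ℝ)..z, a s with hA
  have hAd : ∀ z, HasDerivAt A (a z) z := fun z =>
    intervalIntegral.integral_hasDerivAt_right (ca.intervalIntegrable _ _)
      (ca.stronglyMeasurableAtFilter _ _) ca.continuousAt
  have cA : Continuous A := continuous_iff_continuousAt.2 fun z => (hAd z).continuousAt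
  have hAge : ∀ z, 0 ≤ z → m * z ≤ A z := by
    intro z hz
    have h := intervalIntegral.integral_mono_on (μ := volume) (f := fun _ => m) (g := a) hz
      (continuous_const.intervalIntegrable _ _) (ca.intervalIntegrable _ _) (fun x _ => hma x)
    simp only [intervalIntegral.integral_const, smul_eq_mul, sub_zero] at h
    simp only [hA]; linarith
  have hE : ∀ z, 0 ≤ z → Real.exp (-A z) ≤ Real.exp (-m * z) := by
    intro z hz
    apply Real.exp_le_exp.2
    have := hAge z hz
    linarith
  have cE : Continuous fun z => Real.exp (-A z) := Real.continuous_exp.comp cA.neg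
  have hIexp : IntegrableOn (fun z => Real.exp (-m * z)) (Ioi 0) :=
    exp_neg_integrableOn_Ioi 0 hm
  -- the remainder
  set r : ℝ → ℝ := fun z => (g2 z * a z - g1 z * a1 z) / a z ^ 2 with hr
  have cr : Continuous r := by
    apply Continuous.div
    · fun_prop
    · fun_prop
    · intro z; exact pow_ne_zero _ (hapos z).ne'
  have hrb : ∀ z, |r z| ≤ S / m + Q * P / m ^ 2 := by
    intro z
    have e : r z = g2 z / a z - g1 z * a1 z / a z ^ 2 := by
      have := (hapos z).ne'
      simp only [hr]; field_simp
    rw [e]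
    refine (abs_sub _ _).trans ?_
    rw [abs_div, abs_div, abs_mul, abs_of_pos (hapos z), abs_of_pos (pow_pos (hapos z) 2)]
    have h1 := hma z
    have h2 := hS z
    have h3 := hQ z
    have h4 := hP z
    gcongr
  set B := S / m + Q * P / m ^ 2 with hB
  have hB0 : 0 ≤ B := by positivity
  have i1 : IntegrableOn (fun z => a z * Real.exp (-A z) * g z) (Ioi 0) := by
    refine Integrable.mono' (hIexp.const_mul (M * K))
      ((ca.mul cE).mul cg).aestronglyMeasurable ?_
    refine (ae_restrict_iff' measurableSet_Ioi).2 (Filter.Eventually.of_forall fun z hz => ?_)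
    rw [Real.norm_eq_abs, abs_mul, abs_mul, abs_of_pos (hapos z), abs_of_pos (Real.exp_pos _)]
    have h1 := haM z
    have h2 := hK z
    have h3 := hE z (le_of_lt hz)
    have h4 := Real.exp_pos (-A z)
    calc a z * Real.exp (-A z) * |g z| ≤ M * Real.exp (-m * z) * K := by gcongr
      _ = _ := by ring
  have hb2 : ∀ z ∈ Ioi (0:ℝ), ‖Real.exp (-A z) * r z‖ ≤ B * Real.exp (-m * z) := by
    intro z hz
    rw [Real.norm_eq_abs, abs_mul, abs_of_pos (Real.exp_pos _)]
    have h2 := hrb z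
    have h3 := hE z (le_of_lt hz)
    calc Real.exp (-A z) * |r z| ≤ Real.exp (-m * z) * B := by gcongr
      _ = _ := by ring
  have hb2' : ∀ᵐ z ∂(volume.restrict (Ioi (0:ℝ))),
      ‖Real.exp (-A z) * r z‖ ≤ B * Real.exp (-m * z) :=
    (ae_restrict_iff' measurableSet_Ioi).2 (Filter.Eventually.of_forall hb2)
  have i2 : IntegrableOn (fun z => Real.exp (-A z) * r z) (Ioi 0) :=
    Integrable.mono' (hIexp.const_mul B) (cE.mul cr).aestronglyMeasurable hb2'
  set H : ℝ → ℝ := fun z => -(Real.exp (-A z) * (g z + g1 z / a z)) with hH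
  have hHd : ∀ z, HasDerivAt H (a z * Real.exp (-A z) * g z - Real.exp (-A z) * r z) z := by
    intro z
    have h := ((hAd z).neg.exp.mul ((hg z).add ((hg1 z).div (ha z) (hapos z).ne'))).neg
    refine h.congr_deriv ?_
    have := (hapos z).ne'
    simp only [hr, Pi.add_apply, Pi.div_apply, Pi.neg_apply]
    field_simp
    ring
  have hlim : Filter.Tendsto H Filter.atTop (nhds 0) := by
    have hz : Filter.Tendsto (fun z => (K + Q / m) * Real.exp (-m * z)) Filter.atTop (nhds 0) := by
      have h0 : Filter.Tendsto (fun z : ℝ => Real.exp (-m * z)) Filter.atTop (nhds 0) := by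
        refine Real.tendsto_exp_atBot.comp ?_
        exact Filter.tendsto_id.const_mul_atTop_of_neg (by linarith)
      simpa using h0.const_mul (K + Q / m)
    refine squeeze_zero_norm' ?_ hz
    filter_upwards [Filter.eventually_ge_atTop (0:ℝ)] with z hz
    simp only [hH]
    rw [norm_neg, Real.norm_eq_abs, abs_mul, abs_of_pos (Real.exp_pos _)]
    have h3 := hE z hz
    have h5 : |g z + g1 z / a z| ≤ K + Q / m := by
      refine (abs_add_le _ _).trans ?_
      rw [abs_div, abs_of_pos (hapos z)]
      have h1 := hma z
      have h2 := hK z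
      have h3 := hQ z
      gcongr
    calc Real.exp (-A z) * |g z + g1 z / a z| ≤ Real.exp (-m * z) * (K + Q / m) := by gcongr
      _ = _ := by ring
  have key := integral_Ioi_of_hasDerivAt_of_tendsto' (a := (0:ℝ)) (fun z _ => hHd z) (i1.sub i2) hlim
  rw [integral_sub i1 i2] at key
  have hH0 : H 0 = -(g 0 + g1 0 / a 0) := by simp [hH, hA]
  rw [hH0] at key
  have e : (∫ z in Set.Ioi (0 : ℝ), a z * Real.exp (-(∫ s in (0 : ℝ)..z, a s)) * g z)
      - g 0 - g1 0 / a 0 = ∫ z in Ioi (0:ℝ), Real.exp (-A z) * r z := by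
    simp only [hA] at key ⊢; linarith
  rw [e, ← Real.norm_eq_abs]
  refine (norm_integral_le_of_norm_le (hIexp.const_mul B) hb2').trans (le_of_eq ?_)
  rw [integral_const_mul, integral_exp_mul_Ioi (by linarith) 0]
  simp
  field_simp

lemma aux_rpow {r b γ : ℝ} (h1 : 1 ≤ r) (h2 : r ≤ b) :
    b ^ (-|γ|) ≤ r ^ γ ∧ r ^ γ ≤ b ^ |γ| := by
  have hr : 0 < r := by linarith
  have hb : 0 < b := by linarith
  have up : ∀ δ : ℝ, r ^ δ ≤ b ^ |δ| := fun δ =>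
    (Real.rpow_le_rpow_of_exponent_le h1 (le_abs_self δ)).trans
      (Real.rpow_le_rpow hr.le h2 (abs_nonneg _))
  refine ⟨?_, up γ⟩
  have := up (-γ)
  rw [abs_neg, Real.rpow_neg hr.le] at this
  rw [Real.rpow_neg hb.le]
  exact inv_le_of_inv_le₀ (Real.rpow_pos_of_pos hr _) this

lemma aux_jb {d : ℕ} (β R : ℝ) (v : Euc d) (hv : ‖v‖ ≤ R) (hR : 0 < R) :
    0 < jfloor (-β) v ∧ jfloor (-β) v ≤ (1 + R) ^ |β| ∧
    0 < Real.sqrt (1 + ‖v‖ ^ 2) ^ β ∧ Real.sqrt (1 + ‖v‖ ^ 2) ^ β ≤ (1 + R) ^ |β| ∧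
    (2:ℝ) ^ (-|β|) ≤ jfloor (-β) v * Real.sqrt (1 + ‖v‖ ^ 2) ^ β ∧
    jfloor (-β) v * Real.sqrt (1 + ‖v‖ ^ 2) ^ β ≤ (2:ℝ) ^ |β| := by
  have hn := norm_nonneg v
  have s1 : 1 ≤ Real.sqrt (1 + ‖v‖ ^ 2) := Real.one_le_sqrt.2 (by nlinarith)
  have s2 : Real.sqrt (1 + ‖v‖ ^ 2) ≤ 1 + R := Real.sqrt_le_iff.2 ⟨by linarith, by nlinarith⟩
  have s3 : 0 < Real.sqrt (1 + ‖v‖ ^ 2) := by linarith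
  unfold jfloor
  split_ifs with h
  · have s4 : Real.sqrt (1 + ‖v‖ ^ 2) ≤ 2 := Real.sqrt_le_iff.2 ⟨by linarith, by nlinarith⟩
    refine ⟨one_pos, Real.one_le_rpow (by linarith) (abs_nonneg _), Real.rpow_pos_of_pos s3 _,
      (aux_rpow s1 s2).2, ?_, ?_⟩
    · rw [one_mul]; exact (aux_rpow s1 s4).1
    · rw [one_mul]; exact (aux_rpow s1 s4).2
  · push Not at h
    have hp : 0 < ‖v‖ := by linarith
    have e : ‖v‖ ^ (-β) * Real.sqrt (1 + ‖v‖ ^ 2) ^ β = (Real.sqrt (1 + ‖v‖ ^ 2) / ‖v‖) ^ β := by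
      rw [Real.div_rpow s3.le hp.le, Real.rpow_neg hp.le]; field_simp
    have t1 : 1 ≤ Real.sqrt (1 + ‖v‖ ^ 2) / ‖v‖ := by
      rw [le_div_iff₀ hp, one_mul]; exact Real.le_sqrt_of_sq_le (by linarith)
    have t2 : Real.sqrt (1 + ‖v‖ ^ 2) / ‖v‖ ≤ 2 := by
      rw [div_le_iff₀ hp]; exact Real.sqrt_le_iff.2 ⟨by linarith, by nlinarith⟩
    rw [e]
    refine ⟨Real.rpow_pos_of_pos hp _, ?_, Real.rpow_pos_of_pos s3 _,
      (aux_rpow s1 s2).2, (aux_rpow t1 t2).1, (aux_rpow t1 t2).2⟩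
    have := (aux_rpow (γ := -β) h.le (hv.trans (by linarith : R ≤ 1 + R))).2
    rwa [abs_neg] at this

lemma aux_pointwise {d : ℕ} (β ν₁ ν₂ Cν R : ℝ) (hν₁ : 0 < ν₁) (h12 : ν₁ ≤ ν₂) (hCν : 0 < Cν)
    (hR : 0 < R) (ν : Euc d → Euc d → ℝ)
    (hν : ∀ x v, ν₁ * Real.sqrt (1 + ‖v‖ ^ 2) ^ β ≤ ν x v ∧
        ν x v ≤ ν₂ * Real.sqrt (1 + ‖v‖ ^ 2) ^ β)
    (hνd : ∀ v, ContDiff ℝ 1 fun x => ν x v)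
    (hνb : ∀ x v, Real.sqrt (1 + ‖v‖ ^ 2) ^ (-β) * ‖fderiv ℝ (fun y => ν y v) x‖ ≤ Cν)
    (φ : ℝ → Euc d → ℝ) (t : ℝ) (hφ : ContDiff ℝ 2 (φ t)) (K : ℝ)
    (h0 : ∀ x, |φ t x| ≤ K) (h1 : ∀ x, ‖fderiv ℝ (φ t) x‖ ≤ K)
    (h2 : ∀ x, ‖iteratedFDeriv ℝ 2 (φ t) x‖ ≤ K)
    (ε : ℝ) (hε : 0 < ε) (x v : Euc d) (hv : ‖v‖ ≤ R) :
    |chiAux ν β φ ε t x v - φ t x - ε * (fderiv ℝ (φ t) x v) / ν x v| ≤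
      ((((1 + R) ^ |β| * R) ^ 2 / (ν₁ * (2:ℝ) ^ (-|β|)) +
        ((1 + R) ^ |β| * R) ^ 2 * (Cν * (2:ℝ) ^ |β|) / (ν₁ * (2:ℝ) ^ (-|β|)) ^ 2)
        / (ν₁ * (2:ℝ) ^ (-|β|))) * ε ^ 2 * K := by
  obtain ⟨j0, jJ, b0, -, jb1, jb2⟩ := aux_jb β R v hv hR
  set j := jfloor (-β) v with hj
  set b := Real.sqrt (1 + ‖v‖ ^ 2) ^ β with hb
  set J := (1 + R) ^ |β| with hJ
  set D := (2:ℝ) ^ |β| with hD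
  set c := (2:ℝ) ^ (-|β|) with hc
  have c0 : 0 < c := Real.rpow_pos_of_pos two_pos _
  have D0 : 0 < D := Real.rpow_pos_of_pos two_pos _
  have J0 : 0 < J := j0.trans_le jJ
  have hK0 : 0 ≤ K := (abs_nonneg _).trans (h0 0)
  have hn := norm_nonneg v
  have hνpos : 0 < ν x v := (mul_pos hν₁ b0).trans_le (hν x v).1
  set w : Euc d := (ε * j) • v with hw
  have wn : ‖w‖ ≤ ε * (J * R) := by
    rw [hw, norm_smul, Real.norm_eq_abs, abs_of_pos (mul_pos hε j0), mul_assoc]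
    gcongr
  set p : ℝ → Euc d := fun z => x + (ε * j * z) • v with hp
  have pd : ∀ z, HasDerivAt p w z := by
    intro z
    have := (((hasDerivAt_id z).const_mul (ε * j)).smul_const v).const_add x
    simpa [hp, hw] using this
  have cp : Continuous p := continuous_iff_continuousAt.2 fun z => (pd z).continuousAt
  have hνdiff := hνd v
  have cfν : Continuous (fderiv ℝ fun y => ν y v) := hνdiff.continuous_fderiv (by simp)
  have hφ1 : ContDiff ℝ 1 (fderiv ℝ (φ t)) := hφ.fderiv_right (by norm_num)
  have cff : Continuous (fderiv ℝ (fderiv ℝ (φ t))) := hφ1.continuous_fderiv (by simp)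
  have h2' : ∀ y, ‖fderiv ℝ (fderiv ℝ (φ t)) y‖ ≤ K := by
    intro y
    have := h2 y
    rwa [← norm_iteratedFDeriv_fderiv (n := 1), norm_iteratedFDeriv_one] at this
  have hνb' : ∀ y, ‖fderiv ℝ (fun y => ν y v) y‖ ≤ Cν * b := by
    intro y
    have := hνb y v
    rw [Real.rpow_neg (Real.sqrt_nonneg _), ← hb, inv_mul_le_iff₀ b0] at this
    linarith
  have main := aux_one_dim (fun z => j * ν (p z) v) (fun z => j * fderiv ℝ (fun y => ν y v) (p z) w)
    (fun z => φ t (p z)) (fun z => fderiv ℝ (φ t) (p z) w)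
    (fun z => fderiv ℝ (fderiv ℝ (φ t)) (p z) w w)
    (ν₁ * c) (ν₂ * D) (Cν * D * (ε * (J * R))) K (K * (ε * (J * R))) (K * (ε * (J * R)) ^ 2)
    (mul_pos hν₁ c0)
    (fun z => (((hνdiff.differentiable (by simp)) (p z)).hasFDerivAt.comp_hasDerivAt z (pd z)).const_mul j)
    (fun z => ((hφ.differentiable (by simp)) (p z)).hasFDerivAt.comp_hasDerivAt z (pd z))
    (fun z => by
      have := (((hφ1.differentiable (by simp)) (p z)).hasFDerivAt.comp_hasDerivAt z (pd z))
      have := this.clm_apply (hasDerivAt_const z w)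
      simpa using this)
    (by fun_prop) (by fun_prop)
    (fun z => by
      have := (hν (p z) v).1
      calc ν₁ * c ≤ ν₁ * (j * b) := by gcongr
        _ = j * (ν₁ * b) := by ring
        _ ≤ _ := by gcongr)
    (fun z => by
      have := (hν (p z) v).2
      have n2 : 0 < ν₂ := by linarith
      calc j * ν (p z) v ≤ j * (ν₂ * b) := by gcongr
        _ = ν₂ * (j * b) := by ring
        _ ≤ _ := by gcongr)
    (fun z => by
      rw [abs_mul, abs_of_pos j0, ← Real.norm_eq_abs]
      have h3 := (fderiv ℝ (fun y => ν y v) (p z)).le_opNorm w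
      have h4 := hνb' (p z)
      calc _ ≤ j * (‖fderiv ℝ (fun y => ν y v) (p z)‖ * ‖w‖) := by gcongr
        _ ≤ j * ((Cν * b) * (ε * (J * R))) := by gcongr
        _ = Cν * (j * b) * (ε * (J * R)) := by ring
        _ ≤ _ := by gcongr)
    (fun z => h0 _)
    (fun z => by
      rw [← Real.norm_eq_abs]
      have h3 := (fderiv ℝ (φ t) (p z)).le_opNorm w
      have h4 := h1 (p z)
      refine h3.trans ?_
      gcongr)
    (fun z => by
      rw [← Real.norm_eq_abs]
      have h3 := (fderiv ℝ (fderiv ℝ (φ t)) (p z)).le_opNorm₂ w w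
      have h4 := h2' (p z)
      refine h3.trans ?_
      rw [mul_assoc, ← sq]
      gcongr)
  have p0 : p 0 = x := by simp [hp]
  have e1 : fderiv ℝ (φ t) (p 0) w / (j * ν (p 0) v) = ε * (fderiv ℝ (φ t) x v) / ν x v := by
    rw [p0, hw, map_smul, smul_eq_mul]
    field_simp
  simp only [e1] at main
  rw [p0] at main
  have e2 : chiAux ν β φ ε t x v = ∫ z in Set.Ioi (0 : ℝ),
    j * ν (p z) v * Real.exp (-(∫ s in (0 : ℝ)..z, j * ν (p s) v)) * φ t (p z) := rfl
  rw [e2]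
  refine main.trans (le_of_eq ?_)
  field_simp

/-- Small velocities do not contribute (Lemma 3.4): for every `R > 0` there is `C₀ > 0`,
depending only on `d, β, ν₁, ν₂, C_ν, R`, such that
`|∫_{|v| ≤ R} ν F (χ^ε − φ − ε (v/ν)·∇_x φ) dv| ≤ C₀ ε² ‖φ‖_{W^{2,∞}}`;
the `W^{2,∞}` norm is expressed through an arbitrary uniform bound `K` on `|φ|` and its
first and second space derivatives. -/
theorem small_velocities_estimate (d : ℕ) (hd : 1 ≤ d)
    (β ν₁ ν₂ Cν : ℝ) (hβ : β < 1) (hν₁ : 0 < ν₁) (h12 : ν₁ ≤ ν₂) (hCν : 0 < Cν) :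
    ∀ R > 0, ∃ C₀ > 0, ∀ (ν : Euc d → Euc d → ℝ),
      (Measurable fun p : Euc d × Euc d => ν p.1 p.2) →
      (∀ x v, ν₁ * Real.sqrt (1 + ‖v‖ ^ 2) ^ β ≤ ν x v ∧
        ν x v ≤ ν₂ * Real.sqrt (1 + ‖v‖ ^ 2) ^ β) →
      (∀ v, ContDiff ℝ 1 fun x => ν x v) →
      (∀ x v, Real.sqrt (1 + ‖v‖ ^ 2) ^ (-β) * ‖fderiv ℝ (fun y => ν y v) x‖ ≤ Cν) →
      ∀ (F : Euc d → ℝ), (∀ v, 0 < F v) → Measurable F →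
      Integrable F → (∫ v, F v) = 1 →
      ∀ (φ : ℝ → Euc d → ℝ),
      (ContDiff ℝ (⊤ : ℕ∞) fun p : ℝ × Euc d => φ p.1 p.2) →
      (HasCompactSupport fun p : ℝ × Euc d => φ p.1 p.2) →
      ∀ K : ℝ,
      (∀ t x, |φ t x| ≤ K) →
      (∀ t x, ‖fderiv ℝ (fun y => φ t y) x‖ ≤ K) →
      (∀ t x, ‖iteratedFDeriv ℝ 2 (fun y => φ t y) x‖ ≤ K) →
      ∀ ε ∈ Set.Ioo (0 : ℝ) 1, ∀ t : ℝ, 0 ≤ t → ∀ x : Euc d,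
      |∫ v in Metric.closedBall (0 : Euc d) R,
          ν x v * F v * (chiAux ν β φ ε t x v - φ t x -
            ε * (fderiv ℝ (fun y => φ t y) x v) / ν x v)|
        ≤ C₀ * ε ^ 2 * K := by
  intro R hR
  set B := ((((1 + R) ^ |β| * R) ^ 2 / (ν₁ * (2:ℝ) ^ (-|β|)) +
        ((1 + R) ^ |β| * R) ^ 2 * (Cν * (2:ℝ) ^ |β|) / (ν₁ * (2:ℝ) ^ (-|β|)) ^ 2)
        / (ν₁ * (2:ℝ) ^ (-|β|))) with hB
  have hB0 : 0 < B := by positivity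
  have n2 : 0 < ν₂ := by linarith
  refine ⟨ν₂ * (1 + R) ^ |β| * B, by positivity, ?_⟩
  intro ν _ hν hνd hνb F hF _ hFi hF1 φ hφ _ K h0 h1 h2 ε hε t _ x
  have hK0 : 0 ≤ K := (abs_nonneg _).trans (h0 0 0)
  have hφt : ContDiff ℝ 2 (φ t) := by
    have h : ContDiff ℝ (⊤ : ℕ∞) (fun y : Euc d => φ t y) :=
      hφ.comp (contDiff_const.prodMk contDiff_id)
    exact h.of_le (by norm_cast)
  set C := ν₂ * (1 + R) ^ |β| * B * ε ^ 2 * K with hC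
  have hC0 : 0 ≤ C := by positivity
  have hb : ∀ v ∈ Metric.closedBall (0 : Euc d) R,
      ‖ν x v * F v * (chiAux ν β φ ε t x v - φ t x -
            ε * (fderiv ℝ (fun y => φ t y) x v) / ν x v)‖ ≤ C * F v := by
    intro v hv
    have hv' : ‖v‖ ≤ R := by simpa using hv
    have hp := aux_pointwise β ν₁ ν₂ Cν R hν₁ h12 hCν hR ν hν hνd hνb φ t hφt K (h0 t) (h1 t)
      (h2 t) ε hε.1 x v hv'
    rw [← hB] at hp
    obtain ⟨-, -, b0, bJ, -, -⟩ := aux_jb β R v hv' hR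
    have hνpos : 0 < ν x v := (mul_pos hν₁ b0).trans_le (hν x v).1
    have hνle : ν x v ≤ ν₂ * (1 + R) ^ |β| := (hν x v).2.trans (by gcongr)
    rw [Real.norm_eq_abs, abs_mul, abs_mul, abs_of_pos hνpos, abs_of_pos (hF v)]
    have hFv := hF v
    calc _ ≤ ν₂ * (1 + R) ^ |β| * F v * (B * ε ^ 2 * K) := by gcongr
      _ = C * F v := by rw [hC]; ring
  rw [← Real.norm_eq_abs]
  refine (norm_integral_le_of_norm_le ((hFi.const_mul C).integrableOn)
    ((ae_restrict_iff' measurableSet_closedBall).2 (Filter.Eventually.of_forall hb))).trans ?_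
  refine (setIntegral_le_integral (hFi.const_mul C)
    (Filter.Eventually.of_forall fun v => mul_nonneg hC0 (hF v).le)).trans ?_
  rw [integral_const_mul, hF1, mul_one]
end
end

section
/- Change-of-variables identity for large velocities: let α > 0, β < 1, γ := (α−β)/(1−β), κ > 0, R ≥ 1, and let ν₀ : ℝ^d → [ν₁,ν₂] be measurable with 0 < ν₁ ≤ ν₂. Set ν(x,v) := ν₀(x)|v|^β and F(v) := κ|v|^{−α−d} for |v| ≥ R, and P_ε(x,v,z) := ν₀(x+ε|v|^{−β}vz) exp( −∫₀^z ν₀(x+ε|v|^{−β}vs) ds ). Then for every φ ∈ C_c^∞([0,∞)×ℝ^d), every t ≥ 0, x ∈ ℝ^d and ε > 0: ε^{−γ} ∫_{|v| ≥ R} ν(x,v) F(v) ∫₀^∞ P_ε(x,v,z) [ φ(t, x+ε|v|^{−β}vz) − φ(t,x) ] dz dv = (κ/(1−β)) ∫₀^∞ ∫_{|w| ≥ R^{1−β} ε z} z^γ e^{−z ∫₀¹ ν₀(x+sw) ds} ν₀(x) ν₀(x+w) ( φ(t,x+w) − φ(t,x) ) / |w|^{γ+d} dw dz. -/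
open MeasureTheory Set

noncomputable section

def cvT (d : ℕ) (β c : ℝ) (v : Euc d) : Euc d := (c * ‖v‖ ^ (-β)) • v

def cvT' (d : ℕ) (β c : ℝ) (v : Euc d) : Euc d →L[ℝ] Euc d :=
  (c * ‖v‖ ^ (-β)) • (ContinuousLinearMap.id ℝ (Euc d) +
    ((-β / ‖v‖ ^ 2) • innerSL ℝ v).smulRight v)

lemma cvT_hasFDerivAt (d : ℕ) (β c : ℝ) (v : Euc d) (hv : v ≠ 0) :
    HasFDerivAt (cvT d β c) (cvT' d β c v) v := by
  have hn : 0 < ‖v‖ := norm_pos_iff.mpr hv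
  have h1 := (hasStrictFDerivAt_norm_sq v).hasFDerivAt.rpow_const (p := -β / 2)
    (Or.inl (by positivity))
  have h2 := ((h1.const_mul c).smul (hasFDerivAt_id v))
  have e1 : ∀ u : Euc d, (‖u‖ ^ 2) ^ (-β / 2) = ‖u‖ ^ (-β) := by
    intro u
    rw [← Real.rpow_natCast, ← Real.rpow_mul (norm_nonneg u)]
    congr 1; push_cast; ring
  have e2 : (‖v‖ ^ 2) ^ (-β / 2 - 1) = ‖v‖ ^ (-β) / ‖v‖ ^ 2 := by
    rw [Real.rpow_sub (by positivity), e1, Real.rpow_one]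
  have e3 : cvT d β c = fun u => (c * (‖u‖ ^ 2) ^ (-β / 2)) • id u := by
    funext u; simp only [cvT, e1, id]
  rw [e3]
  refine h2.congr_fderiv ?_
  ext1 u
  simp only [cvT', e1, e2]
  simp [smul_smul]
  ring_nf

lemma cvT'_det (d : ℕ) (β c : ℝ) (v : Euc d) (hv : v ≠ 0) :
    (cvT' d β c v).det = (c * ‖v‖ ^ (-β)) ^ d * (1 - β) := by
  have hn : 0 < ‖v‖ := norm_pos_iff.mpr hv
  have h : ((cvT' d β c v : Euc d →L[ℝ] Euc d) : Euc d →ₗ[ℝ] Euc d) =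
      (c * ‖v‖ ^ (-β)) • LinearMap.transvection
        (((-β / ‖v‖ ^ 2) • innerSL ℝ v : Euc d →L[ℝ] ℝ) : Euc d →ₗ[ℝ] ℝ) v := by
    ext1 u
    simp [cvT', LinearMap.transvection.apply]
  rw [ContinuousLinearMap.det, h, LinearMap.det_smul, LinearMap.transvection.det]
  simp
  left
  field_simp
  ring

lemma cvT_norm (d : ℕ) (β c : ℝ) (hc : 0 < c) (v : Euc d) (hv : v ≠ 0) :
    ‖cvT d β c v‖ = c * ‖v‖ ^ (1 - β) := by
  have hn : 0 < ‖v‖ := norm_pos_iff.mpr hv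
  rw [cvT, norm_smul, Real.norm_of_nonneg (by positivity), mul_assoc]
  congr 1
  rw [show 1 - β = -β + 1 by ring, Real.rpow_add_one hn.ne']

lemma cvT_injOn (d : ℕ) (β c : ℝ) (hβ : β < 1) (hc : 0 < c) :
    InjOn (cvT d β c) {v | v ≠ 0} := by
  intro u hu v hv h
  have hnu : 0 < ‖u‖ := norm_pos_iff.mpr hu
  have h1 : ‖cvT d β c u‖ = ‖cvT d β c v‖ := by rw [h]
  rw [cvT_norm d β c hc u hu, cvT_norm d β c hc v hv] at h1
  have h2 := mul_left_cancel₀ hc.ne' h1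
  have h3 : ‖u‖ = ‖v‖ :=
    (Real.rpow_left_inj (norm_nonneg _) (norm_nonneg _) (by linarith : (1 - β) ≠ 0)).mp h2
  simp only [cvT] at h
  rw [← h3] at h
  exact smul_right_injective _ (by positivity : c * ‖u‖ ^ (-β) ≠ 0) h

lemma cvT_image (d : ℕ) (β c R : ℝ) (hβ : β < 1) (hc : 0 < c) (hR : 1 ≤ R) :
    cvT d β c '' {v | R ≤ ‖v‖} = {w | R ^ (1 - β) * c ≤ ‖w‖} := by
  have hb : 0 < 1 - β := by linarith
  ext w
  constructor
  · rintro ⟨v, hv, rfl⟩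
    have hv' : R ≤ ‖v‖ := hv
    have hn : 0 < ‖v‖ := by linarith
    rw [Set.mem_setOf_eq]
    rw [cvT_norm d β c hc v (norm_pos_iff.mp hn), mul_comm]
    gcongr
  · intro hw
    have hw' : R ^ (1 - β) * c ≤ ‖w‖ := hw
    have hwn : 0 < ‖w‖ := lt_of_lt_of_le (by positivity) hw'
    set r : ℝ := (‖w‖ / c) ^ (1 / (1 - β)) with hr
    have hr0 : 0 < r := by positivity
    have hrp : r ^ (1 - β) = ‖w‖ / c := by
      rw [hr, ← Real.rpow_mul (by positivity), one_div, inv_mul_cancel₀ hb.ne', Real.rpow_one]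
    have hnorm : ‖(r / ‖w‖) • w‖ = r := by
      rw [norm_smul, Real.norm_of_nonneg (by positivity)]
      field_simp
    refine ⟨(r / ‖w‖) • w, ?_, ?_⟩
    · rw [Set.mem_setOf_eq]
      rw [hnorm]
      have : R ^ (1 - β) ≤ r ^ (1 - β) := by
        rw [hrp, le_div_iff₀ hc]; exact hw'
      exact (Real.rpow_le_rpow_iff (by linarith) hr0.le hb).mp this
    · rw [cvT, hnorm, smul_smul]
      have : c * r ^ (-β) * (r / ‖w‖) = 1 := by
        have h2 : r ^ (1 - β) = r ^ (-β) * r := by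
          rw [show 1 - β = -β + 1 by ring, Real.rpow_add_one hr0.ne']
        have h3 : r ^ (-β) * r = ‖w‖ / c := by rw [← h2, hrp]
        calc c * r ^ (-β) * (r / ‖w‖) = c * (r ^ (-β) * r) / ‖w‖ := by ring
          _ = 1 := by rw [h3]; field_simp
      rw [this, one_smul]

/-- Power bookkeeping. -/
lemma cv_powers (d : ℕ) (α β γ ε z r : ℝ) (hβ : β < 1) (hγ : γ = (α - β) / (1 - β))
    (hε : 0 < ε) (hz : 0 < z) (hr : 0 < r) :
    (ε * z * r ^ (-β)) ^ d * (z ^ γ / (ε * z * r ^ (1 - β)) ^ (γ + (d : ℝ))) =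
      ε ^ (-γ) * (r ^ β * r ^ (-(α + (d : ℝ)))) := by
  have hb : 1 - β ≠ 0 := by linarith
  have hg : (1 - β) * γ = α - β := by rw [hγ]; field_simp
  rw [← Real.rpow_natCast, Real.mul_rpow (by positivity) (by positivity),
    Real.mul_rpow hε.le hz.le, Real.mul_rpow (by positivity) (by positivity),
    Real.mul_rpow hε.le hz.le, ← Real.rpow_mul hr.le, ← Real.rpow_mul hr.le, ← Real.rpow_add hr,
    Real.rpow_add hε, Real.rpow_add hz, Real.rpow_neg hε.le,
    show (1 - β) * (γ + (d : ℝ)) = -β * d - (β + -(α + d)) by rw [mul_add, hg]; ring,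
    Real.rpow_sub hr]
  have := Real.rpow_pos_of_pos hε γ
  have := Real.rpow_pos_of_pos hz γ
  have := Real.rpow_pos_of_pos hε (d : ℝ)
  have := Real.rpow_pos_of_pos hz (d : ℝ)
  have := Real.rpow_pos_of_pos hr (-β * d)
  have := Real.rpow_pos_of_pos hr (β + -(α + d))
  field_simp

/-- Change-of-variables identity for large velocities (substitution `w = ε z |v|^{−β} v`):
for `ν(x,v) = ν₀(x)|v|^β` and `F(v) = κ|v|^{−α−d}` on `|v| ≥ R`, with
`P_ε(x,v,z) = ν₀(x+ε|v|^{−β}vz) exp(−∫₀^z ν₀(x+ε|v|^{−β}vs) ds)`. -/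
theorem change_of_variables_large_velocities (d : ℕ) (hd : 1 ≤ d)
    (α β γ κ R ν₁ ν₂ : ℝ)
    (hα : 0 < α) (hβ : β < 1) (hγ : γ = (α - β) / (1 - β)) (hκ : 0 < κ)
    (hR : 1 ≤ R) (hν₁ : 0 < ν₁) (h12 : ν₁ ≤ ν₂)
    (ν₀ : Euc d → ℝ) (hν₀_meas : Measurable ν₀) (hν₀ : ∀ x, ν₀ x ∈ Set.Icc ν₁ ν₂)
    (φ : ℝ → Euc d → ℝ)
    (hφ : ContDiff ℝ (⊤ : ℕ∞) fun p : ℝ × Euc d => φ p.1 p.2)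
    (hφc : HasCompactSupport fun p : ℝ × Euc d => φ p.1 p.2)
    (t : ℝ) (ht : 0 ≤ t) (x : Euc d) (ε : ℝ) (hε : 0 < ε)
    (hInt1 : Integrable
      (fun p : Euc d × ℝ =>
        (ν₀ x * ‖p.1‖ ^ β) * (κ * ‖p.1‖ ^ (-(α + (d : ℝ)))) *
          (ν₀ (x + (ε * ‖p.1‖ ^ (-β) * p.2) • p.1) *
            Real.exp (-(∫ s in (0 : ℝ)..p.2, ν₀ (x + (ε * ‖p.1‖ ^ (-β) * s) • p.1)))) *
          (φ t (x + (ε * ‖p.1‖ ^ (-β) * p.2) • p.1) - φ t x))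
      ((volume.restrict {v : Euc d | R ≤ ‖v‖}).prod (volume.restrict (Set.Ioi (0 : ℝ)))))
    (hInt2 : Integrable
      (fun p : ℝ × Euc d =>
        p.1 ^ γ * Real.exp (-(p.1 * ∫ s in (0 : ℝ)..1, ν₀ (x + s • p.2))) *
          ν₀ x * ν₀ (x + p.2) * (φ t (x + p.2) - φ t x) / ‖p.2‖ ^ (γ + (d : ℝ)))
      (((volume.restrict (Set.Ioi (0 : ℝ))).prod volume).restrict
        {p : ℝ × Euc d | R ^ (1 - β) * ε * p.1 ≤ ‖p.2‖})) :
    ε ^ (-γ) * ∫ v in {v : Euc d | R ≤ ‖v‖},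
        (ν₀ x * ‖v‖ ^ β) * (κ * ‖v‖ ^ (-(α + (d : ℝ)))) *
          ∫ z in Set.Ioi (0 : ℝ),
            (ν₀ (x + (ε * ‖v‖ ^ (-β) * z) • v) *
              Real.exp (-(∫ s in (0 : ℝ)..z, ν₀ (x + (ε * ‖v‖ ^ (-β) * s) • v)))) *
            (φ t (x + (ε * ‖v‖ ^ (-β) * z) • v) - φ t x)
      = κ / (1 - β) * ∫ z in Set.Ioi (0 : ℝ),
          ∫ w in {w : Euc d | R ^ (1 - β) * ε * z ≤ ‖w‖},
            z ^ γ * Real.exp (-(z * ∫ s in (0 : ℝ)..1, ν₀ (x + s • w))) *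
              ν₀ x * ν₀ (x + w) * (φ t (x + w) - φ t x) / ‖w‖ ^ (γ + (d : ℝ)) := by
  have hb : 0 < 1 - β := by linarith
  have hS : MeasurableSet {v : Euc d | R ≤ ‖v‖} :=
    measurableSet_le measurable_const measurable_norm
  have hswap := integral_integral_swap (f := fun (v : Euc d) (z : ℝ) =>
        (ν₀ x * ‖v‖ ^ β) * (κ * ‖v‖ ^ (-(α + (d : ℝ)))) *
          (ν₀ (x + (ε * ‖v‖ ^ (-β) * z) • v) *
            Real.exp (-(∫ s in (0 : ℝ)..z, ν₀ (x + (ε * ‖v‖ ^ (-β) * s) • v)))) *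
          (φ t (x + (ε * ‖v‖ ^ (-β) * z) • v) - φ t x)) hInt1
  have hL : (∫ v in {v : Euc d | R ≤ ‖v‖},
        (ν₀ x * ‖v‖ ^ β) * (κ * ‖v‖ ^ (-(α + (d : ℝ)))) *
          ∫ z in Set.Ioi (0 : ℝ),
            (ν₀ (x + (ε * ‖v‖ ^ (-β) * z) • v) *
              Real.exp (-(∫ s in (0 : ℝ)..z, ν₀ (x + (ε * ‖v‖ ^ (-β) * s) • v)))) *
            (φ t (x + (ε * ‖v‖ ^ (-β) * z) • v) - φ t x)) =
      ∫ v in {v : Euc d | R ≤ ‖v‖}, ∫ z in Set.Ioi (0 : ℝ),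
        (ν₀ x * ‖v‖ ^ β) * (κ * ‖v‖ ^ (-(α + (d : ℝ)))) *
          (ν₀ (x + (ε * ‖v‖ ^ (-β) * z) • v) *
            Real.exp (-(∫ s in (0 : ℝ)..z, ν₀ (x + (ε * ‖v‖ ^ (-β) * s) • v)))) *
          (φ t (x + (ε * ‖v‖ ^ (-β) * z) • v) - φ t x) := by
    congr 1
    funext v
    rw [← integral_const_mul]
    congr 1
    funext z
    ring
  rw [hL, hswap, ← integral_const_mul, ← integral_const_mul]
  refine setIntegral_congr_fun measurableSet_Ioi ?_
  intro z hz
  have hz : 0 < z := hz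
  have hc : 0 < ε * z := by positivity
  show ε ^ (-γ) * _ = κ / (1 - β) * _
  have himg : {w : Euc d | R ^ (1 - β) * ε * z ≤ ‖w‖} = cvT d β (ε * z) '' {v | R ≤ ‖v‖} := by
    rw [cvT_image d β (ε * z) R hβ hc hR]
    simp only [mul_assoc]
  have hne : ∀ v ∈ {v : Euc d | R ≤ ‖v‖}, v ≠ 0 := by
    intro v hv
    have hv' : R ≤ ‖v‖ := hv
    exact norm_pos_iff.mp (by linarith)
  rw [himg, integral_image_eq_integral_abs_det_fderiv_smul volume hS
    (fun v hv => (cvT_hasFDerivAt d β (ε * z) v (hne v hv)).hasFDerivWithinAt)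
    ((cvT_injOn d β (ε * z) hβ hc).mono hne), ← integral_const_mul, ← integral_const_mul]
  refine setIntegral_congr_fun hS ?_
  intro v hv
  have hv0 := hne v hv
  have hn : 0 < ‖v‖ := norm_pos_iff.mpr hv0
  have hp := cv_powers d α β γ ε z ‖v‖ hβ hγ hε hz hn
  have hw : (ε * ‖v‖ ^ (-β) * z) • v = cvT d β (ε * z) v := by
    rw [cvT]; congr 1; ring
  have hexp : (∫ s in (0 : ℝ)..z, ν₀ (x + (ε * ‖v‖ ^ (-β) * s) • v)) =
      z * ∫ s in (0 : ℝ)..1, ν₀ (x + s • cvT d β (ε * z) v) := by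
    have h := intervalIntegral.smul_integral_comp_mul_left (a := 0) (b := 1)
      (fun s => ν₀ (x + (ε * ‖v‖ ^ (-β) * s) • v)) z
    rw [mul_zero, mul_one, smul_eq_mul] at h
    rw [← h]
    congr 1
    refine intervalIntegral.integral_congr fun s _ => ?_
    show ν₀ _ = ν₀ _
    rw [← hw, smul_smul]
    congr 3
    ring
  simp only [hexp, hw, cvT'_det d β (ε * z) v hv0, cvT_norm d β (ε * z) hc v hv0, smul_eq_mul]
  rw [abs_of_nonneg (by positivity)]
  generalize Real.exp _ = E
  generalize ν₀ (x + cvT d β (ε * z) v) = N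
  generalize φ t (x + cvT d β (ε * z) v) - φ t x = D
  calc _ = (ε ^ (-γ) * (‖v‖ ^ β * ‖v‖ ^ (-(α + (d : ℝ))))) * (κ * ν₀ x * N * E * D) := by ring
    _ = _ := by
      rw [← hp]
      field_simp
end
end
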